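/- Let λ be a Lie multiplication on ℂ⁴. Then λ has level two if and only if λ is isomorphic to one of: n₄ (with [e₁,e₂] = e₃, [e₁,e₃] = e₄), r₂⊕𝔞₂ (with [e₁,e₂] = e₂), r₃(1)⊕𝔞₁ (with [e₁,e₂] = e₂, [e₁,e₃] = e₃), g₄,₁(α) (with [e₁,e₂] = αe₂, [e₁,e₃] = e₃, [e₁,e₄] = e₄) for some α ∈ ℂ with α ≠ 0 and α ≠ 1, or g₄,₂ (with [e₁,e₂] = e₂ + e₃, [e₁,e₃] = e₃, [e₁,e₄] = e₄). -/

import Mathlib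

noncomputable section

abbrev V (n : ℕ) : Type := Fin n → ℂ

abbrev Bil (n : ℕ) : Type := V n →ₗ[ℂ] V n →ₗ[ℂ] V n

instance BilTop (n : ℕ) : TopologicalSpace (Bil n) :=
  TopologicalSpace.induced (fun μ : Bil n => fun x y : V n => μ x y) inferInstance

/-- The change-of-basis action of a linear automorphism on multiplications. -/
def act {n : ℕ} (g : V n ≃ₗ[ℂ] V n) (μ : Bil n) : Bil n :=
  LinearMap.mk₂ ℂ (fun x y => g (μ (g.symm x) (g.symm y)))
    (fun x x' y => by simp)
    (fun c x y => by simp)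
    (fun x y y' => by simp)
    (fun c x y => by simp)

/-- The orbit of a multiplication under the change-of-basis action. -/
def orb {n : ℕ} (μ : Bil n) : Set (Bil n) :=
  Set.range fun g : V n ≃ₗ[ℂ] V n => act g μ

/-- Two multiplications are isomorphic iff they lie in the same orbit. -/
def Isom {n : ℕ} (μ ν : Bil n) : Prop := ∃ g : V n ≃ₗ[ℂ] V n, act g μ = ν

def levelOne {n : ℕ} (lam : Bil n) : Prop :=
  lam ≠ 0 ∧ closure (orb lam) ⊆ orb lam ∪ {0}

def levelTwo {n : ℕ} (lam : Bil n) : Prop :=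
  (∀ μ ∈ closure (orb lam) \ orb lam, closure (orb μ) ⊆ orb μ ∪ {0}) ∧
  ∃ μ ∈ closure (orb lam) \ orb lam, μ ≠ 0

/-- `E n k` is the standard basis vector `e_{k+1}` of `ℂⁿ` (0-indexed `k`). -/
def E (n k : ℕ) : V n := fun m => if (m : ℕ) = k then 1 else 0

/-- The bilinear multiplication determined by a table of products of basis vectors. -/
def ofTable {n : ℕ} (c : Fin n → Fin n → V n) : Bil n :=
  LinearMap.mk₂ ℂ (fun x y => ∑ i : Fin n, ∑ j : Fin n, (x i * y j) • c i j)
    (fun x x' y => by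
      simp [add_mul, add_smul, Finset.sum_add_distrib])
    (fun a x y => by
      simp [Finset.smul_sum, smul_smul, mul_assoc])
    (fun x y y' => by
      simp [mul_add, add_smul, Finset.sum_add_distrib])
    (fun a x y => by
      simp [Finset.smul_sum, smul_smul, mul_assoc, mul_left_comm])

def JordanMul {n : ℕ} (lam : Bil n) : Prop :=
  (∀ x y : V n, lam x y = lam y x) ∧
  ∀ x y : V n, lam (lam x x) (lam y x) = lam (lam (lam x x) y) x

def LieMul {n : ℕ} (lam : Bil n) : Prop :=
  (∀ x : V n, lam x x = 0) ∧
  ∀ x y z : V n, lam x (lam y z) + lam y (lam z x) + lam z (lam x y) = 0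

def AssocMul {n : ℕ} (lam : Bil n) : Prop :=
  ∀ x y z : V n, lam (lam x y) z = lam x (lam y z)

/-- `n₄` on `ℂ⁴`: `[e₁,e₂] = e₃`, `[e₁,e₃] = e₄`. -/
def n4 : Bil 4 :=
  ofTable fun i j =>
    if i.val = 0 ∧ j.val = 1 then E 4 2
    else if i.val = 1 ∧ j.val = 0 then -E 4 2
    else if i.val = 0 ∧ j.val = 2 then E 4 3
    else if i.val = 2 ∧ j.val = 0 then -E 4 3
    else 0

/-- `r₂ ⊕ 𝔞₂` on `ℂ⁴`: `[e₁,e₂] = e₂`. -/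
def r2a2 : Bil 4 :=
  ofTable fun i j =>
    if i.val = 0 ∧ j.val = 1 then E 4 1
    else if i.val = 1 ∧ j.val = 0 then -E 4 1
    else 0

/-- `r₃(1) ⊕ 𝔞₁` on `ℂ⁴`: `[e₁,e₂] = e₂`, `[e₁,e₃] = e₃`. -/
def r31a1 : Bil 4 :=
  ofTable fun i j =>
    if i.val = 0 ∧ (j.val = 1 ∨ j.val = 2) then E 4 j.val
    else if j.val = 0 ∧ (i.val = 1 ∨ i.val = 2) then -E 4 i.val
    else 0

/-- `g₄,₁(α)` on `ℂ⁴`: `[e₁,e₂] = α e₂`, `[e₁,e₃] = e₃`, `[e₁,e₄] = e₄`. -/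
def g41 (α : ℂ) : Bil 4 :=
  ofTable fun i j =>
    if i.val = 0 ∧ j.val = 1 then α • E 4 1
    else if i.val = 1 ∧ j.val = 0 then -(α • E 4 1)
    else if i.val = 0 ∧ 2 ≤ j.val then E 4 j.val
    else if j.val = 0 ∧ 2 ≤ i.val then -E 4 i.val
    else 0

/-- `g₄,₂` on `ℂ⁴`: `[e₁,e₂] = e₂ + e₃`, `[e₁,e₃] = e₃`, `[e₁,e₄] = e₄`. -/
def g42 : Bil 4 :=
  ofTable fun i j =>
    if i.val = 0 ∧ j.val = 1 then E 4 1 + E 4 2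
    else if i.val = 1 ∧ j.val = 0 then -(E 4 1 + E 4 2)
    else if i.val = 0 ∧ 2 ≤ j.val then E 4 j.val
    else if j.val = 0 ∧ 2 ≤ i.val then -E 4 i.val
    else 0

open Filter Topology

abbrev Fn : Type := V 4 →ₗ[ℂ] ℂ

def LE1 {n : ℕ} (μ : Bil n) : Prop := closure (orb μ) ⊆ orb μ ∪ {0}

@[simp] lemma act_apply {n : ℕ} (g : V n ≃ₗ[ℂ] V n) (μ : Bil n) (x y : V n) :
    act g μ x y = g (μ (g.symm x) (g.symm y)) := rfl

lemma act_act {n : ℕ} (g k : V n ≃ₗ[ℂ] V n) (μ : Bil n) :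
    act g (act k μ) = act (k.trans g) μ := by
  refine LinearMap.ext₂ fun x y => ?_
  simp

lemma act_refl {n : ℕ} (μ : Bil n) : act (LinearEquiv.refl ℂ (V n)) μ = μ := by
  refine LinearMap.ext₂ fun x y => ?_
  simp

lemma Isom.symm {n : ℕ} {μ ν : Bil n} (h : Isom μ ν) : Isom ν μ := by
  obtain ⟨g, rfl⟩ := h
  exact ⟨g.symm, by rw [act_act]; simp [act_refl]⟩

lemma Isom.trans {n : ℕ} {μ ν ρ : Bil n} (h : Isom μ ν) (h' : Isom ν ρ) : Isom μ ρ := by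
  obtain ⟨g, rfl⟩ := h
  obtain ⟨k, rfl⟩ := h'
  exact ⟨g.trans k, by rw [act_act]⟩

lemma Isom.refl {n : ℕ} (μ : Bil n) : Isom μ μ := ⟨_, act_refl μ⟩

lemma mem_orb {n : ℕ} {μ ν : Bil n} : ν ∈ orb μ ↔ Isom μ ν := Iff.rfl

lemma orb_eq {n : ℕ} {μ ν : Bil n} (h : Isom μ ν) : orb μ = orb ν := by
  ext ρ
  rw [mem_orb, mem_orb]
  exact ⟨fun k => h.symm.trans k, fun k => h.trans k⟩

lemma levelTwo_congr {n : ℕ} {μ ν : Bil n} (h : Isom μ ν) : levelTwo μ ↔ levelTwo ν := by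
  unfold levelTwo
  rw [orb_eq h]

lemma LE1_congr {n : ℕ} {μ ν : Bil n} (h : Isom μ ν) : LE1 μ ↔ LE1 ν := by
  unfold LE1
  rw [orb_eq h]

lemma not_levelTwo_of_LE1 {n : ℕ} {μ : Bil n} (h : LE1 μ) : ¬ levelTwo μ := by
  rintro ⟨-, ν, ⟨h1, h2⟩, h3⟩
  rcases h h1 with h4 | h4
  · exact h2 h4
  · exact h3 h4

lemma isom_zero {n : ℕ} {μ : Bil n} (h : Isom 0 μ) : μ = 0 := by
  obtain ⟨g, rfl⟩ := h
  refine LinearMap.ext₂ fun x y => ?_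
  simp

lemma tendsto_bil {n : ℕ} {α : Type*} {l : Filter α} {G : α → Bil n} {μ : Bil n}
    (h : ∀ x y, Tendsto (fun t => G t x y) l (𝓝 (μ x y))) : Tendsto G l (𝓝 μ) := by
  rw [nhds_induced, tendsto_comap_iff, tendsto_pi_nhds]
  intro x
  rw [tendsto_pi_nhds]
  intro y
  exact h x y

lemma continuous_eval {n : ℕ} (x y : V n) : Continuous (fun μ : Bil n => μ x y) := by
  have h : Continuous (fun μ : Bil n => fun x y : V n => μ x y) := continuous_induced_dom
  exact (continuous_apply y).comp ((continuous_apply x).comp h)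

lemma bil_expand {n : ℕ} (μ : Bil n) (x v : V n) :
    μ x v = ∑ i, v i • μ x (Pi.single i 1) := by
  conv_lhs => rw [pi_eq_sum_univ' v]
  simp [map_sum]
  
lemma continuous_eval' {n : ℕ} (x : V n) {φ : Bil n → V n} (h : Continuous φ) :
    Continuous (fun μ : Bil n => μ x (φ μ)) := by
  simp_rw [fun μ : Bil n => bil_expand μ x (φ μ)]
  refine continuous_finsetSum _ fun i _ => ?_
  exact ((continuous_apply i).comp h).smul (continuous_eval _ _)

lemma mem_closure_fam {n : ℕ} {lam μ : Bil n} (G : ℂ → Bil n)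
    (h1 : ∀ t, t ≠ 0 → Isom lam (G t))
    (h2 : ∀ x y, Tendsto (fun t => G t x y) (𝓝[≠] 0) (𝓝 (μ x y))) :
    μ ∈ closure (orb lam) := by
  refine mem_closure_of_tendsto (tendsto_bil h2) ?_
  filter_upwards [self_mem_nhdsWithin] with t ht
  exact h1 t ht

lemma tr_eq {n : ℕ} (A : V n →ₗ[ℂ] V n) :
    LinearMap.trace ℂ (V n) A = ∑ i, A (Pi.single i 1) i := by
  rw [LinearMap.trace_eq_matrix_trace ℂ (Pi.basisFun ℂ (Fin n))]
  simp [Matrix.trace]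

lemma continuous_tr {n : ℕ} (x : V n) :
    Continuous (fun μ : Bil n => LinearMap.trace ℂ (V n) (μ x)) := by
  simp_rw [tr_eq]
  exact continuous_finsetSum _ fun i _ => (continuous_apply i).comp (continuous_eval _ _)

lemma continuous_tr2 {n : ℕ} (x : V n) :
    Continuous (fun μ : Bil n => LinearMap.trace ℂ (V n) (μ x ∘ₗ μ x)) := by
  simp_rw [tr_eq]
  refine continuous_finsetSum _ fun i _ => (continuous_apply i).comp ?_
  exact continuous_eval' _ (continuous_eval _ _)

lemma alt_swap {n : ℕ} {μ : Bil n} (h : ∀ x, μ x x = 0) (x y : V n) : μ x y = - μ y x := by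
  have := h (x + y)
  simp [h] at this
  exact eq_neg_of_add_eq_zero_left this

lemma ext_basis4 {μ ν : Bil 4} (b : Module.Basis (Fin 4) ℂ (V 4)) (hμ : ∀ x, μ x x = 0)
    (hν : ∀ x, ν x x = 0) (h01 : μ (b 0) (b 1) = ν (b 0) (b 1))
    (h02 : μ (b 0) (b 2) = ν (b 0) (b 2)) (h03 : μ (b 0) (b 3) = ν (b 0) (b 3))
    (h12 : μ (b 1) (b 2) = ν (b 1) (b 2)) (h13 : μ (b 1) (b 3) = ν (b 1) (b 3))
    (h23 : μ (b 2) (b 3) = ν (b 2) (b 3)) : μ = ν := by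
  refine b.ext fun i => b.ext fun j => ?_
  have s : ∀ x y, μ x y = ν x y → μ y x = ν y x := fun x y h => by
    rw [alt_swap hμ, alt_swap hν, h]
  fin_cases i <;> fin_cases j <;> simp [hμ, hν] <;> first | assumption | (apply s; assumption)

lemma act_alt {n : ℕ} {μ : Bil n} (g : V n ≃ₗ[ℂ] V n) (h : ∀ x, μ x x = 0) (x : V n) :
    act g μ x x = 0 := by simp [h]

/-- isomorphism criterion from two bases -/
lemma isom_basis {μ ν : Bil 4} (b b' : Module.Basis (Fin 4) ℂ (V 4)) (hμ : ∀ x, μ x x = 0)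
    (hν : ∀ x, ν x x = 0)
    (h01 : b.equiv b' (Equiv.refl _) (μ (b 0) (b 1)) = ν (b' 0) (b' 1))
    (h02 : b.equiv b' (Equiv.refl _) (μ (b 0) (b 2)) = ν (b' 0) (b' 2))
    (h03 : b.equiv b' (Equiv.refl _) (μ (b 0) (b 3)) = ν (b' 0) (b' 3))
    (h12 : b.equiv b' (Equiv.refl _) (μ (b 1) (b 2)) = ν (b' 1) (b' 2))
    (h13 : b.equiv b' (Equiv.refl _) (μ (b 1) (b 3)) = ν (b' 1) (b' 3))
    (h23 : b.equiv b' (Equiv.refl _) (μ (b 2) (b 3)) = ν (b' 2) (b' 3)) : Isom μ ν := by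
  refine ⟨b.equiv b' (Equiv.refl _), ext_basis4 b' (act_alt _ hμ) hν ?_ ?_ ?_ ?_ ?_ ?_⟩ <;>
    simpa

lemma exists_basis4 {v : Fin 4 → V 4} (h : LinearIndependent ℂ v) :
    ∃ b : Module.Basis (Fin 4) ℂ (V 4), ∀ i, b i = v i :=
  ⟨basisOfLinearIndependentOfCardEqFinrank h (by simp), fun i => by simp⟩

lemma li_four {a b c d : V 4} (h : ∀ p q r s : ℂ, p • a + q • b + r • c + s • d = 0 →
    p = 0 ∧ q = 0 ∧ r = 0 ∧ s = 0) : LinearIndependent ℂ ![a, b, c, d] := by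
  rw [Fintype.linearIndependent_iff]
  intro g hg i
  obtain ⟨h0, h1, h2, h3⟩ := h (g 0) (g 1) (g 2) (g 3) (by simpa [Fin.sum_univ_four] using hg)
  fin_cases i <;> assumption

lemma basis_four {a b c d : V 4} (h : ∀ p q r s : ℂ, p • a + q • b + r • c + s • d = 0 →
    p = 0 ∧ q = 0 ∧ r = 0 ∧ s = 0) :
    ∃ B : Module.Basis (Fin 4) ℂ (V 4), B 0 = a ∧ B 1 = b ∧ B 2 = c ∧ B 3 = d := by
  obtain ⟨B, hB⟩ := exists_basis4 (li_four h)
  exact ⟨B, by simp [hB], by simp [hB], by simp [hB], by simp [hB]⟩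

lemma extend_three {a b c : V 4} (h : ∀ p q r : ℂ, p • a + q • b + r • c = 0 →
    p = 0 ∧ q = 0 ∧ r = 0) : ∃ d, ∀ p q r s : ℂ, p • a + q • b + r • c + s • d = 0 →
    p = 0 ∧ q = 0 ∧ r = 0 ∧ s = 0 := by
  have h3 : LinearIndependent ℂ ![a, b, c] := by
    rw [Fintype.linearIndependent_iff]
    intro g hg i
    obtain ⟨h0, h1, h2⟩ := h (g 0) (g 1) (g 2) (by simpa [Fin.sum_univ_three] using hg)
    fin_cases i <;> assumption
  obtain ⟨d, hd⟩ := exists_linearIndependent_snoc_of_lt_finrank h3 (by simp)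
  refine ⟨d, fun p q r s hs => ?_⟩
  rw [Fintype.linearIndependent_iff] at hd
  have := hd ![p, q, r, s] (by
    rw [← hs]; simp [Fin.sum_univ_four, Fin.snoc]; rfl)
  exact ⟨this 0, this 1, this 2, this 3⟩

lemma extend_two {a b : V 4} (h : ∀ p q : ℂ, p • a + q • b = 0 →
    p = 0 ∧ q = 0) : ∃ c, ∀ p q r : ℂ, p • a + q • b + r • c = 0 →
    p = 0 ∧ q = 0 ∧ r = 0 := by
  have h3 : LinearIndependent ℂ ![a, b] := by
    rw [Fintype.linearIndependent_iff]
    intro g hg i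
    obtain ⟨h0, h1⟩ := h (g 0) (g 1) (by simpa [Fin.sum_univ_two] using hg)
    fin_cases i <;> assumption
  obtain ⟨d, hd⟩ := exists_linearIndependent_snoc_of_lt_finrank h3 (by simp)
  refine ⟨d, fun p q r hs => ?_⟩
  rw [Fintype.linearIndependent_iff] at hd
  have := hd ![p, q, r] (by
    rw [← hs]; simp [Fin.sum_univ_three, Fin.snoc])
  exact ⟨this 0, this 1, this 2⟩

def M (c : ℂ) (f h : Fn) (u : V 4) : Bil 4 :=
  LinearMap.mk₂ ℂ (fun x y => c • (f x • y - f y • x) + (f x * h y - f y * h x) • u)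
    (fun x x' y => by simp only [map_add]; module)
    (fun a x y => by simp only [map_smul, smul_eq_mul]; module)
    (fun x y y' => by simp only [map_add]; module)
    (fun a x y => by simp only [map_smul, smul_eq_mul]; module)

lemma M_apply (c : ℂ) (f h : Fn) (u x y : V 4) :
    M c f h u x y = c • (f x • y - f y • x) + (f x * h y - f y * h x) • u := rfl

lemma M_alt (c : ℂ) (f h : Fn) (u x : V 4) : M c f h u x x = 0 := by
  rw [M_apply]; module

lemma act_M (g : V 4 ≃ₗ[ℂ] V 4) (c : ℂ) (f h : Fn) (u : V 4) :
    act g (M c f h u) = M c (f ∘ₗ g.symm.toLinearMap) (h ∘ₗ g.symm.toLinearMap) (g u) := by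
  refine LinearMap.ext₂ fun x y => ?_
  simp [M_apply]

lemma M_eq (c : ℂ) (f h : Fn) (u x : V 4) :
    M c f h u x = (c * f x) • LinearMap.id - c • f.smulRight x + f x • h.smulRight u
      - h x • f.smulRight u := by
  refine LinearMap.ext fun y => ?_
  simp [M_apply]
  module

lemma tr_M (c : ℂ) (f h : Fn) (u x : V 4) (hu : f u = 0) :
    LinearMap.trace ℂ (V 4) (M c f h u x) = (3 * c + h u) * f x := by
  rw [M_eq]
  simp [LinearMap.trace_smulRight, hu]
  ring

lemma tr2_M (c : ℂ) (f h : Fn) (u x : V 4) (hu : f u = 0) :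
    LinearMap.trace ℂ (V 4) (M c f h u x ∘ₗ M c f h u x)
      = (2 * c ^ 2 + (c + h u) ^ 2) * f x ^ 2 := by
  have e : M c f h u x ∘ₗ M c f h u x = (c * f x) ^ 2 • LinearMap.id
      - (c ^ 2 * f x) • f.smulRight x
      + (2 * c * f x ^ 2 + f x ^ 2 * h u) • h.smulRight u
      - (h x * 2 * c * f x + f x * h x * h u) • f.smulRight u := by
    refine LinearMap.ext fun y => ?_
    simp [M_apply, hu]
    module
  rw [e]
  simp [LinearMap.trace_smulRight, hu]
  ring

def ND (f h : Fn) (u : V 4) : Prop :=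
  u ≠ 0 ∧ f u = 0 ∧ ∃ x0 x1, f x0 = 1 ∧ f x1 = 0 ∧ h x0 = 0 ∧ h x1 = 1

lemma compl_basis {f h : Fn} {x0 x1 u : V 4} (h1 : f x0 = 1) (h2 : f x1 = 0) (h3 : h x0 = 0)
    (h4 : h x1 = 1) (hu : u ≠ 0) (h5 : f u = 0) (h6 : h u = 0) :
    ∃ B : Module.Basis (Fin 4) ℂ (V 4), B 0 = x0 ∧ B 1 = x1 ∧ B 2 = u ∧ f (B 3) = 0
      ∧ h (B 3) = 0 := by
  have li : ∀ p q r : ℂ, p • x0 + q • x1 + r • u = 0 → p = 0 ∧ q = 0 ∧ r = 0 := by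
    intro p q r e
    have ef := congrArg f e
    have eh := congrArg h e
    simp [h1, h2, h3, h4, h5, h6] at ef eh
    subst ef eh
    simpa [hu] using e
  obtain ⟨d, hd⟩ := extend_three li
  obtain ⟨B, b0, b1, b2, b3⟩ := basis_four (a := x0) (b := x1) (c := u)
    (d := d - f d • x0 - h d • x1) (by
      intro p q r s e
      have := hd (p - s * f d) (q - s * h d) r s (by rw [← e]; module)
      obtain ⟨e1, e2, e3, e4⟩ := this
      subst e4
      simpa [e3] using And.intro e1 e2)
  exact ⟨B, b0, b1, b2, by simp [b3, h1, h2, h3, h4], by simp [b3, h1, h2, h3, h4]⟩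

lemma exists_ker {f h : Fn} {x0 x1 : V 4} (h1 : f x0 = 1) (h2 : f x1 = 0) (h3 : h x0 = 0)
    (h4 : h x1 = 1) : ∃ u : V 4, u ≠ 0 ∧ f u = 0 ∧ h u = 0 := by
  have li : ∀ p q : ℂ, p • x0 + q • x1 = 0 → p = 0 ∧ q = 0 := by
    intro p q e
    have ef := congrArg f e
    have eh := congrArg h e
    simp [h1, h2, h3, h4] at ef eh
    exact ⟨ef, eh⟩
  obtain ⟨d, hd⟩ := extend_two li
  refine ⟨d - f d • x0 - h d • x1, ?_, by simp [h1, h2, h3, h4], by simp [h1, h2, h3, h4]⟩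
  intro e
  have := hd (- f d) (- h d) 1 (by rw [← e]; module)
  simp at this

lemma ND_basis {f h : Fn} {u : V 4} (H : ND f h u) :
    ∃ B : Module.Basis (Fin 4) ℂ (V 4), (f (B 0) = 1 ∧ f (B 1) = 0 ∧ f (B 2) = 0 ∧ f (B 3) = 0)
      ∧ (h (B 0) = 0 ∧ h (B 1) = 1 ∧ h (B 2) = 0 ∧ h (B 3) = 0)
      ∧ u = if h u = 0 then B 2 else h u • B 1 := by
  obtain ⟨hu, fu, x0, x1, h1, h2, h3, h4⟩ := H
  by_cases k : h u = 0
  · obtain ⟨B, b0, b1, b2, b3, b4⟩ := compl_basis h1 h2 h3 h4 hu fu k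
    exact ⟨B, by simp [*], by simp [*], by simp [*]⟩
  · obtain ⟨w, w0, w1, w2⟩ := exists_ker h1 h2 h3 h4
    obtain ⟨B, b0, b1, b2, b3, b4⟩ := compl_basis (f := f) (h := h) (x0 := x0)
      (x1 := (h u)⁻¹ • u) h1 (by simp [fu]) h3 (by simp [k]) w0 w1 w2
    exact ⟨B, by simp [*], by simp [*], by simp [*]⟩

lemma M_isom {c : ℂ} {f h f' h' : Fn} {u u' : V 4} (H : ND f h u) (H' : ND f' h' u')
    (e : h u = h' u') : Isom (M c f h u) (M c f' h' u') := by
  obtain ⟨B, ⟨p0, p1, p2, p3⟩, ⟨q0, q1, q2, q3⟩, hB⟩ := ND_basis H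
  obtain ⟨B', ⟨p0', p1', p2', p3'⟩, ⟨q0', q1', q2', q3'⟩, hB'⟩ := ND_basis H'
  refine ⟨B.equiv B' (Equiv.refl _), ?_⟩
  rw [act_M]
  have e1 : f ∘ₗ (B.equiv B' (Equiv.refl _)).symm.toLinearMap = f' := by
    refine B'.ext fun i => ?_
    fin_cases i <;> simp [*]
  have e2 : h ∘ₗ (B.equiv B' (Equiv.refl _)).symm.toLinearMap = h' := by
    refine B'.ext fun i => ?_
    fin_cases i <;> simp [*]
  have e3 : B.equiv B' (Equiv.refl _) u = u' := by
    rw [hB, hB', ← e]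
    split_ifs <;> simp
  rw [e1, e2, e3]

lemma M_smul (s c : ℂ) (f h : Fn) (u : V 4) : M c (s • f) h u = M (s * c) f h (s • u) := by
  refine LinearMap.ext₂ fun x y => ?_
  simp [M_apply]
  module

lemma ND_smul {s : ℂ} (hs : s ≠ 0) {f h : Fn} {u : V 4} (H : ND f h u) : ND (s • f) h (s⁻¹ • u) := by
  obtain ⟨hu, fu, x0, x1, h1, h2, h3, h4⟩ := H
  refine ⟨by simp [hu, hs], by simp [fu], s⁻¹ • x0, x1, ?_, ?_, ?_, ?_⟩ <;> simp [*]

lemma M_isom' {s c : ℂ} (hs : s ≠ 0) {f h f' h' : Fn} {u u' : V 4} (H : ND f h u)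
    (H' : ND f' h' u') (e : s * h u = h' u') : Isom (M c f h u) (M (s * c) f' h' u') := by
  have := M_isom (c := c) H (ND_smul hs H') (by simp [← e, hs])
  rwa [M_smul, smul_smul, mul_inv_cancel₀ hs, one_smul] at this

/-- scalar type -/
lemma M_zero_isom {c c' : ℂ} {f f' h h' : Fn} (hc : c ≠ 0) (hc' : c' ≠ 0) (hf : f ≠ 0)
    (hf' : f' ≠ 0) : Isom (M c f h 0) (M c' f' h' 0) := by
  have key : ∀ f : Fn, f ≠ 0 → ∃ h u, ND f h u := by
    intro f hf
    obtain ⟨x, hx⟩ : ∃ x, f x ≠ 0 := by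
      by_contra! k
      exact hf (LinearMap.ext k)
    obtain ⟨y, hy⟩ := exists_linearIndependent_pair_of_one_lt_finrank (R := ℂ) (M := V 4) (by simp)
      (show x ≠ 0 by rintro rfl; simp at hx)
    rw [LinearIndependent.pair_iff] at hy
    set z := y - (f y / f x) • x with hz
    have fz : f z = 0 := by simp [hz, hx]
    have z0 : z ≠ 0 := by
      intro e
      have := hy (-(f y / f x)) 1 (by rw [← e, hz]; module)
      simp at this
    obtain ⟨i, hi⟩ : ∃ i, z i ≠ 0 := by
      by_contra! k
      exact z0 (funext k)
    refine ⟨(z i)⁻¹ • LinearMap.proj i - ((z i)⁻¹ * x i / f x) • f, z, z0, fz, (f x)⁻¹ • x, z, ?_, ?_, ?_, ?_⟩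
    · simp [hx]
    · exact fz
    · simp; field_simp; simp
    · simp [fz, hi]
  obtain ⟨k, u, H⟩ := key f hf
  obtain ⟨k', u', H'⟩ := key ((c'/c) • f') (by simp [hc, hc', hf'])
  obtain ⟨B, ⟨p0, p1, p2, p3⟩, -⟩ := ND_basis H
  obtain ⟨B', ⟨p0', p1', p2', p3'⟩, -⟩ := ND_basis H'
  have e : M c' f' h' 0 = M c ((c'/c) • f') h 0 := by
    rw [M_smul]
    refine LinearMap.ext₂ fun x y => ?_
    simp [M_apply, div_mul_cancel₀ c' hc]
  rw [e]
  refine ⟨B.equiv B' (Equiv.refl _), ?_⟩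
  rw [act_M]
  have e1 : f ∘ₗ (B.equiv B' (Equiv.refl _)).symm.toLinearMap = (c'/c) • f' := by
    refine B'.ext fun i => ?_
    fin_cases i <;> simp_all
  rw [e1]
  refine LinearMap.ext₂ fun x y => ?_
  simp [M_apply]

lemma exists_coord {u : V 4} (hu : u ≠ 0) : ∃ i, u i ≠ 0 := by
  by_contra! k
  exact hu (funext k)

lemma n3_class {ν : Bil 4} (hA : ∀ x, ν x x = 0)
    (hB : ∀ x y z w i j, ν x y i * ν z w j = ν x y j * ν z w i)
    (hT : ∀ x, LinearMap.trace ℂ (V 4) (ν x) = 0) :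
    ν = 0 ∨ ∃ f h u, ND f h u ∧ h u = 0 ∧ ν = M 0 f h u := by
  by_cases h0 : ∀ x y, ν x y = 0
  · left
    exact LinearMap.ext₂ h0
  right
  push Not at h0
  obtain ⟨x0, y0, hu⟩ := h0
  set u := ν x0 y0 with hu'
  obtain ⟨i, hi⟩ := exists_coord hu
  have e : ∀ x y, ν x y = (ν x y i / u i) • u := by
    intro x y
    funext j
    have := hB x y x0 y0 i j
    rw [← hu'] at this
    simp
    field_simp
    linear_combination -this
  have nu : ∀ x, ν x u = 0 := by
    intro x
    have e1 : ν x = ((u i)⁻¹ • (LinearMap.proj i ∘ₗ ν x)).smulRight u := by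
      refine LinearMap.ext fun y => ?_
      conv_lhs => rw [e]
      simp [div_eq_inv_mul]
    have := hT x
    rw [e1, LinearMap.trace_smulRight] at this
    rw [e x u, div_eq_inv_mul]
    simp at this
    simp [this]
  have un : ∀ x, ν u x = 0 := fun x => by rw [alt_swap hA, nu, neg_zero]
  set f : Fn := (u i)⁻¹ • (LinearMap.proj i ∘ₗ ν.flip y0) with hf
  set h : Fn := (u i)⁻¹ • (LinearMap.proj i ∘ₗ ν x0) with hh
  have f1 : ∀ x, ν x y0 = f x • u := fun x => by rw [e]; simp [hf, div_eq_inv_mul]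
  have h1 : ∀ x, ν x0 x = h x • u := fun x => by rw [e]; simp [hh, div_eq_inv_mul]
  have fx : f x0 = 1 := by simp [hf, ← hu', hi]
  have fy : f y0 = 0 := by simp [hf, hA]
  have hx : h x0 = 0 := by simp [hh, hA]
  have hy : h y0 = 1 := by simp [hh, ← hu', hi]
  have fu : f u = 0 := by simp [hf, un]
  have hu2 : h u = 0 := by simp [hh, nu]
  refine ⟨f, h, u, ⟨hu, fu, x0, y0, fx, fy, hx, hy⟩, hu2, ?_⟩
  obtain ⟨B, b0, b1, b2, b3, b4⟩ := compl_basis fx fy hx hy hu fu hu2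
  refine ext_basis4 B hA (M_alt _ _ _ _) ?_ ?_ ?_ ?_ ?_ ?_
  · simp [b0, b1, M_apply, fx, fy, hx, hy, ← hu']
  · simp [b0, b2, M_apply, fx, fu, hx, hu2, nu]
  · simp [b0, b3, b4, M_apply, fx, hx, h1]
  · simp [b1, b2, M_apply, fy, fu, hy, hu2, nu]
  · rw [alt_swap hA]
    simp [b1, b3, b4, M_apply, fy, hy, f1]
  · simp [b2, b3, b4, M_apply, fu, hu2, un]

lemma n3_LE1 {f h : Fn} {u : V 4} (H : ND f h u) (hu : h u = 0) : LE1 (M 0 f h u) := by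
  intro ν hν
  have key : closure (orb (M 0 f h u)) ⊆ {ν : Bil 4 | (∀ x, ν x x = 0) ∧
      (∀ x y z w i j, ν x y i * ν z w j = ν x y j * ν z w i) ∧
      ∀ x, LinearMap.trace ℂ (V 4) (ν x) = 0} := by
    refine closure_minimal ?_ ?_
    · rintro _ ⟨g, rfl⟩
      simp only [act_M]
      refine ⟨M_alt _ _ _ _, ?_, ?_⟩
      · intro x y z w i j
        simp [M_apply]
        ring
      · intro x
        rw [tr_M _ _ _ _ _ (by simp [H.2.1])]
        simp [hu]
    · simp only [Set.ofPred_and, Set.ofPred_forall]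
      refine IsClosed.inter ?_ (IsClosed.inter ?_ ?_)
      · exact isClosed_iInter fun x => isClosed_eq (continuous_eval _ _) continuous_const
      · refine isClosed_iInter fun x => isClosed_iInter fun y => isClosed_iInter fun z =>
          isClosed_iInter fun w => isClosed_iInter fun i => isClosed_iInter fun j => ?_
        exact isClosed_eq
          (((continuous_apply i).comp (continuous_eval _ _)).mul
            ((continuous_apply j).comp (continuous_eval _ _)))
          (((continuous_apply j).comp (continuous_eval _ _)).mul
            ((continuous_apply i).comp (continuous_eval _ _)))
      · exact isClosed_iInter fun x => isClosed_eq (continuous_tr _) continuous_const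
  obtain ⟨hA, hB, hT⟩ := key hν
  rcases n3_class hA hB hT with h0 | ⟨f', h', u', H', hu', rfl⟩
  · right; exact h0
  · left; exact M_isom H H' (by rw [hu, hu'])

lemma zero_LE1 : LE1 (0 : Bil 4) := by
  intro ν hν
  right
  have key : closure (orb (0 : Bil 4)) ⊆ {ν : Bil 4 | ∀ x y, ν x y = 0} := by
    refine closure_minimal ?_ ?_
    · rintro _ ⟨g, rfl⟩
      simp
    · simp only [Set.ofPred_forall]
      exact isClosed_iInter fun x => isClosed_iInter fun y =>
        isClosed_eq (continuous_eval _ _) continuous_const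
  exact LinearMap.ext₂ (key hν)

lemma scal_LE1 (c : ℂ) (f h : Fn) : LE1 (M c f h 0) := by
  by_cases h0 : c = 0 ∨ f = 0
  · have : M c f h 0 = 0 := by
      refine LinearMap.ext₂ fun x y => ?_
      rcases h0 with rfl | rfl <;> simp [M_apply]
    rw [this]
    exact zero_LE1
  push Not at h0
  intro ν hν
  have key : closure (orb (M c f h 0)) ⊆ {ν : Bil 4 | ∀ x y, (3 : ℂ) • ν x y =
      LinearMap.trace ℂ (V 4) (ν x) • y - LinearMap.trace ℂ (V 4) (ν y) • x} := by
    refine closure_minimal ?_ ?_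
    · rintro _ ⟨g, rfl⟩
      intro x y
      simp only [act_M]
      rw [tr_M _ _ _ _ _ (by simp), tr_M _ _ _ _ _ (by simp)]
      simp [M_apply]
      module
    · simp only [Set.ofPred_forall]
      refine isClosed_iInter fun x => isClosed_iInter fun y => ?_
      have e1 := continuous_eval x y
      have e2 := continuous_tr x
      have e3 := continuous_tr y
      exact isClosed_eq (e1.const_smul (3 : ℂ)) ((e2.smul continuous_const).sub (e3.smul continuous_const))
  have hk := key hν
  set F : Fn := (1 / 3 : ℂ) • (LinearMap.trace ℂ (V 4) ∘ₗ ν) with hF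
  have e : ν = M 1 F h 0 := by
    refine LinearMap.ext₂ fun x y => ?_
    have := hk x y
    have e2 : ν x y = (1 / 3 : ℂ) • ((3 : ℂ) • ν x y) := by module
    rw [e2, this]
    simp [M_apply, hF]
    module
  by_cases hF0 : F = 0
  · right
    rw [e, hF0]
    refine LinearMap.ext₂ fun x y => ?_
    simp [M_apply]
  · left
    rw [e]
    exact M_zero_isom h0.1 one_ne_zero h0.2 hF0

lemma ultra_lim {α : Type*} (𝒰 : Ultrafilter α) (φ : α → ℂ) (q : α → ℂ) (q0 : ℂ)
    (hq : Tendsto q 𝒰 (𝓝 q0)) (h : ∀ᶠ a in (𝒰 : Filter α), φ a ^ 2 = q a) :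
    ∃ l, Tendsto φ 𝒰 (𝓝 l) := by
  have hb : ∀ᶠ a in (𝒰 : Filter α), φ a ∈ Metric.closedBall (0 : ℂ) (‖q0‖ + 2) := by
    have h1 : ∀ᶠ a in (𝒰 : Filter α), ‖q a‖ < ‖q0‖ + 1 :=
      (hq.norm).eventually (gt_mem_nhds (by linarith))
    filter_upwards [h, h1] with a ha ha1
    rw [← ha, norm_pow] at ha1
    rw [mem_closedBall_zero_iff]
    nlinarith [norm_nonneg (φ a), norm_nonneg q0]
  obtain ⟨l, -, hl⟩ := (isCompact_closedBall (0 : ℂ) (‖q0‖ + 2)).ultrafilter_le_nhds'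
    (𝒰.map φ) hb
  exact ⟨l, hl⟩

def Nn (c : ℂ) (ρ : Bil 4) (F : V 4 → ℂ) (x y : V 4) : V 4 := ρ x y - c • (F x • y - F y • x)

lemma tr_M' (c : ℂ) (f h : Fn) (u x : V 4) :
    LinearMap.trace ℂ (V 4) (M c f h u x) = (3 * c + h u) * f x - h x * f u := by
  rw [M_eq]
  simp [LinearMap.trace_smulRight]
  ring

lemma lim_class {c κ : ℂ} {ν : Bil 4} (F : Fn) (hA : ∀ x, ν x x = 0)
    (hD : ∀ x y z, F x • Nn c ν F y z + F y • Nn c ν F z x + F z • Nn c ν F x y = 0)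
    (hB : ∀ x y z w i j, Nn c ν F x y i * Nn c ν F z w j = Nn c ν F x y j * Nn c ν F z w i)
    (hT : ∀ x, LinearMap.trace ℂ (V 4) (ν x) = (3 * c + κ) * F x) :
    LE1 ν ∨ ∃ h u, ND F h u ∧ h u = κ ∧ ν = M c F h u := by
  by_cases hF : F = 0
  · left
    subst hF
    have : ∀ x y, Nn c ν (0 : Fn) x y = ν x y := by simp [Nn]
    rcases n3_class hA (by simpa [this] using hB) (by simpa using hT) with rfl | ⟨f, h, u, H, k, rfl⟩
    · exact zero_LE1
    · exact n3_LE1 H k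
  obtain ⟨x, hx⟩ : ∃ x, F x ≠ 0 := by
    by_contra! k
    exact hF (LinearMap.ext k)
  obtain ⟨x0, h0⟩ : ∃ x, F x = 1 := ⟨(F x)⁻¹ • x, by simp [hx]⟩
  have Nalt : ∀ x y, Nn c ν F x y = - Nn c ν F y x := by
    intro x y
    simp only [Nn]
    rw [alt_swap hA x y]
    module
  have Nform : ∀ y z, Nn c ν F y z = F y • Nn c ν F x0 z - F z • Nn c ν F x0 y := by
    intro y z
    have := hD x0 y z
    rw [h0, Nalt z x0] at this
    rw [← sub_eq_zero, ← this]
    module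
  have nuN : ∀ x y, ν x y = c • (F x • y - F y • x) + Nn c ν F x y := by
    intro x y
    simp [Nn]
  by_cases hN : ∀ y, Nn c ν F x0 y = 0
  · left
    have : ν = M c F 0 0 := by
      refine LinearMap.ext₂ fun x y => ?_
      rw [nuN, Nform]
      simp [hN, M_apply]
    rw [this]
    exact scal_LE1 _ _ _
  right
  push Not at hN
  obtain ⟨y1, hy1⟩ := hN
  set u := Nn c ν F x0 y1 with hu
  obtain ⟨i, hi⟩ := exists_coord hy1
  set h : Fn := (u i)⁻¹ • (LinearMap.proj i ∘ₗ (ν x0 - c • (F x0 • LinearMap.id - F.smulRight x0)))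
    with hh
  have hN : ∀ y, Nn c ν F x0 y = h y • u := by
    intro y
    have e : h y = (u i)⁻¹ * Nn c ν F x0 y i := by
      simp [hh, Nn]
    rw [e]
    funext j
    have := hB x0 y x0 y1 i j
    rw [← hu] at this
    simp
    field_simp
    linear_combination -this
  have e : ν = M c F h u := by
    refine LinearMap.ext₂ fun x y => ?_
    rw [nuN, Nform, M_apply, hN, hN]
    module
  have hx0 : h x0 = 0 := by
    simp [hh, hA, h0]
  have hy : h y1 = 1 := by
    have := hN y1
    rw [← hu] at this
    have := congrFun this i
    simp at this
    exact (mul_right_cancel₀ hi (by rw [one_mul]; exact this)).symm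
  have t0 := hT x0
  have t1 := hT (y1 - F y1 • x0)
  rw [e, tr_M'] at t0 t1
  simp [h0, hx0, hy] at t0 t1
  exact ⟨h, u, ⟨hy1, t1, x0, y1 - F y1 • x0, h0, by simp [h0], hx0, by simp [hx0, hy]⟩, t0, e⟩

lemma exists_ab {c κ : ℂ} (hk : c ≠ 0 ∨ κ ≠ 0) :
    ∃ a b : ℂ, a * (3 * c + κ) ^ 2 + b * (2 * c ^ 2 + (c + κ) ^ 2) = 1 := by
  by_cases h : 3 * c + κ = 0
  · have e : κ = - 3 * c := by linear_combination h
    subst e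
    have hc : c ≠ 0 := by
      rintro rfl
      simp at hk
    refine ⟨0, (6 * c ^ 2)⁻¹, ?_⟩
    field_simp
    ring
  · exact ⟨((3 * c + κ) ^ 2)⁻¹, 0, by field_simp; ring⟩

def qf (a b : ℂ) (ρ : Bil 4) (x : V 4) : ℂ :=
  a * LinearMap.trace ℂ (V 4) (ρ x) ^ 2 + b * LinearMap.trace ℂ (V 4) (ρ x ∘ₗ ρ x)

lemma qf_M {a b c : ℂ} {f h : Fn} {u : V 4} (hu : f u = 0)
    (hab : a * (3 * c + h u) ^ 2 + b * (2 * c ^ 2 + (c + h u) ^ 2) = 1) (x : V 4) :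
    qf a b (M c f h u) x = f x ^ 2 := by
  rw [qf, tr_M _ _ _ _ _ hu, tr2_M _ _ _ _ _ hu]
  linear_combination f x ^ 2 * hab

lemma M_levelTwo {c : ℂ} {f h : Fn} {u : V 4} (H : ND f h u) (hk : c ≠ 0 ∨ h u ≠ 0) :
    levelTwo (M c f h u) := by
  obtain ⟨a, b, hab⟩ := exists_ab hk
  have horb : ∀ ρ : Bil 4, ∃ F : Fn, ρ ∈ orb (M c f h u) → ∃ h' u', F ≠ 0 ∧ F u' = 0 ∧ h' u' = h u ∧
      ρ = M c F h' u' := by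
    intro ρ
    by_cases hρ : ρ ∈ orb (M c f h u)
    · obtain ⟨g, rfl⟩ := hρ
      refine ⟨f ∘ₗ g.symm.toLinearMap, fun _ => ⟨h ∘ₗ g.symm.toLinearMap, g u, ?_, ?_, ?_, ?_⟩⟩
      · obtain ⟨-, -, x0, -, e, -⟩ := H
        intro k
        have := LinearMap.congr_fun k (g x0)
        simp [e] at this
      · simp [H.2.1]
      · simp
      · exact act_M _ _ _ _ _
    · exact ⟨0, fun k => absurd k hρ⟩
  choose F hF using horb
  have hq : ∀ ρ ∈ orb (M c f h u), ∀ x, F ρ x ^ 2 = qf a b ρ x := by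
    intro ρ hρ x
    obtain ⟨h', u', -, h1, h2, h3⟩ := hF ρ hρ
    conv_rhs => rw [h3]
    rw [qf_M h1 (by rw [h2]; exact hab)]
  constructor
  · rintro ν ⟨hν, hν'⟩
    obtain ⟨𝒰, h1, h2⟩ := mem_closure_iff_ultrafilter.1 hν
    have hU : ∀ᶠ ρ in (𝒰 : Filter (Bil 4)), ρ ∈ orb (M c f h u) := h1
    have cont : ∀ {X : Type} [TopologicalSpace X] {φ : Bil 4 → X}, Continuous φ →
        Tendsto φ 𝒰 (𝓝 (φ ν)) := fun hφ => hφ.continuousAt.tendsto.mono_left h2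
    have hlim : ∀ x, ∃ l, Tendsto (fun ρ => F ρ x) 𝒰 (𝓝 l) := by
      intro x
      refine ultra_lim 𝒰 _ (fun ρ => qf a b ρ x) (qf a b ν x) ?_ ?_
      · apply cont (φ := fun ρ => qf a b ρ x)
        exact (continuous_const.mul ((continuous_tr x).pow 2)).add
          (continuous_const.mul (continuous_tr2 x))
      · filter_upwards [hU] with ρ hρ using hq ρ hρ x
    choose l hl using hlim
    let Fl : Fn :=
      { toFun := l
        map_add' := fun x y => by
          refine tendsto_nhds_unique (hl (x + y)) ?_
          simp only [map_add]
          exact (hl x).add (hl y)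
        map_smul' := fun s x => by
          refine tendsto_nhds_unique (hl (s • x)) ?_
          simp only [map_smul]
          exact (hl x).const_smul s }
    have hFl : ∀ x, Tendsto (fun ρ => F ρ x) 𝒰 (𝓝 (Fl x)) := hl
    have hev : ∀ x y, Tendsto (fun ρ : Bil 4 => ρ x y) 𝒰 (𝓝 (ν x y)) :=
      fun x y => cont (continuous_eval x y)
    have hN : ∀ x y, Tendsto (fun ρ : Bil 4 => Nn c ρ (F ρ) x y) 𝒰 (𝓝 (Nn c ν Fl x y)) := by
      intro x y
      exact (hev x y).sub ((((hFl x).smul_const y).sub ((hFl y).smul_const x)).const_smul c)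
    have hNi : ∀ x y i, Tendsto (fun ρ : Bil 4 => Nn c ρ (F ρ) x y i) 𝒰 (𝓝 (Nn c ν Fl x y i)) :=
      fun x y i => (tendsto_pi_nhds.1 (hN x y)) i
    have Nval : ∀ ρ ∈ orb (M c f h u), ∃ h' u', F ρ u' = 0 ∧ h' u' = h u ∧ ρ = M c (F ρ) h' u' ∧
        ∀ x y, Nn c ρ (F ρ) x y = (F ρ x * h' y - F ρ y * h' x) • u' := by
      intro ρ hρ
      obtain ⟨h', u', -, h1, h2, h3⟩ := hF ρ hρ
      refine ⟨h', u', h1, h2, h3, fun x y => ?_⟩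
      simp only [Nn]
      conv_lhs => rw [h3]
      rw [M_apply, ← h3]
      module
    have LC : LE1 ν ∨ ∃ h' u', ND Fl h' u' ∧ h' u' = h u ∧ ν = M c Fl h' u' := by
      refine lim_class (c := c) (κ := h u) (ν := ν) Fl ?_ ?_ ?_ ?_
      · intro x
        refine tendsto_nhds_unique (hev x x) (Tendsto.congr' ?_ tendsto_const_nhds)
        filter_upwards [hU] with ρ hρ
        obtain ⟨h', u', -, -, e, -⟩ := Nval ρ hρ
        rw [e, M_alt]
      · intro x y z
        refine tendsto_nhds_unique ((((hFl x).smul (hN y z)).add ((hFl y).smul (hN z x))).add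
          ((hFl z).smul (hN x y))) (Tendsto.congr' ?_ tendsto_const_nhds)
        filter_upwards [hU] with ρ hρ
        obtain ⟨h', u', -, -, -, e⟩ := Nval ρ hρ
        simp only [e]
        module
      · intro x y z w i j
        refine tendsto_nhds_unique ((hNi x y i).mul (hNi z w j)) (Tendsto.congr' ?_
          ((hNi x y j).mul (hNi z w i)))
        filter_upwards [hU] with ρ hρ
        obtain ⟨h', u', -, -, -, e⟩ := Nval ρ hρ
        simp only [e]
        simp
        ring
      · intro x
        refine tendsto_nhds_unique (cont (continuous_tr x)) (Tendsto.congr' ?_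
          ((hFl x).const_mul (3 * c + h u)))
        filter_upwards [hU] with ρ hρ
        obtain ⟨h', u', e1, e2, e, -⟩ := Nval ρ hρ
        conv_rhs => rw [e]
        rw [tr_M _ _ _ _ _ e1, e2]
    rcases LC with h3 | ⟨h', u', H', e1, e2⟩
    · exact h3
    · refine absurd ?_ hν'
      rw [e2]
      exact M_isom H H' e1.symm
  · obtain ⟨hu, fu, x0, x1, h1, h2, h3, h4⟩ := id H
    obtain ⟨w, w0, w1, w2⟩ := exists_ker h1 h2 h3 h4
    refine ⟨M 0 f h w, ⟨?_, ?_⟩, ?_⟩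
    · refine mem_closure_fam (fun t => if w + (t * h u) • x1 = 0 then M c f h u else
        M (t * c) f h (w + (t * h u) • x1)) ?_ ?_
      · intro t ht
        split_ifs with hs
        · exact Isom.refl _
        · refine M_isom' ht H ⟨hs, by simp [w1, h2], x0, x1, h1, h2, h3, h4⟩ ?_
          simp [w2, h4]
      · intro x y
        have ne : ∀ t : ℂ, w + (t * h u) • x1 ≠ 0 := by
          intro t e
          have := congrArg h e
          simp [w2, h4] at this
          rw [← e] at w0
          rcases this with this | this <;> simp [this] at e <;> simp_all
        simp only [ne, if_false]
        refine Tendsto.mono_left ?_ nhdsWithin_le_nhds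
        have : Continuous (fun t : ℂ => M (t * c) f h (w + (t * h u) • x1) x y) := by
          simp only [M_apply]
          fun_prop
        have := this.tendsto 0
        simpa using this
    · intro k
      obtain ⟨h', u', e0, -⟩ := hF _ k
      apply e0
      refine LinearMap.ext fun x => ?_
      have := hq _ k x
      rw [qf, tr_M _ _ _ _ _ w1, tr2_M _ _ _ _ _ w1, w2] at this
      simpa using this
    · intro k
      have := LinearMap.congr_fun₂ k x0 x1
      simp [M_apply, h1, h2, h3, h4] at this
      exact w0 this

lemma expand4 (B : Module.Basis (Fin 4) ℂ (V 4)) (v : V 4) :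
    ∃ p q r s : ℂ, v = p • B 0 + q • B 1 + r • B 2 + s • B 3 := by
  refine ⟨B.repr v 0, B.repr v 1, B.repr v 2, B.repr v 3, ?_⟩
  have := B.sum_repr v
  rw [Fin.sum_univ_four] at this
  exact this.symm

lemma n3_of_basis {ν : Bil 4} (hA : ∀ x, ν x x = 0) {x y z w : V 4}
    (li : ∀ p q r s : ℂ, p • x + q • y + r • z + s • w = 0 → p = 0 ∧ q = 0 ∧ r = 0 ∧ s = 0)
    (h01 : ν x y = z) (h02 : ν x z = 0) (h03 : ν x w = 0) (h12 : ν y z = 0) (h13 : ν y w = 0)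
    (h23 : ν z w = 0) : ∃ f h u, ND f h u ∧ h u = 0 ∧ ν = M 0 f h u := by
  obtain ⟨B, b0, b1, b2, b3⟩ := basis_four li
  refine ⟨B.coord 0, B.coord 1, B 2, ⟨B.ne_zero 2, by simp, B 0, B 1, ?_⟩, by simp, ?_⟩
  · simp
  · refine ext_basis4 B hA (M_alt _ _ _ _) ?_ ?_ ?_ ?_ ?_ ?_
    · simp [M_apply]; simp [b0, b1, b2, h01]
    · simp [M_apply]; simp [b0, b2, h02]
    · simp [M_apply]; simp [b0, b3, h03]
    · simp [M_apply]; simp [b1, b2, h12]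
    · simp [M_apply]; simp [b1, b3, h13]
    · simp [M_apply]; simp [b2, b3, h23]

lemma Z_step {ν : Bil 4} (hA : ∀ x, ν x x = 0) (hz : ∀ x y, ν x (ν x y) = 0) {x y z w : V 4}
    (li : ∀ p q r s : ℂ, p • x + q • y + r • z + s • w = 0 → p = 0 ∧ q = 0 ∧ r = 0 ∧ s = 0)
    (h01 : ν x y = z) : ∃ r : ℂ, ν x (w - r • y) = 0 := by
  obtain ⟨B, b0, b1, b2, b3⟩ := basis_four li
  obtain ⟨p, q, r, s, e⟩ := expand4 B (ν x w)
  rw [b0, b1, b2, b3] at e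
  have e2 := hz x w
  have h02 : ν x z = 0 := by rw [← h01]; exact hz _ _
  rw [e] at e2
  simp only [map_add, map_smul, hA, h01, h02, smul_zero, zero_add, add_zero] at e2
  rw [e] at e2
  obtain ⟨l1, l2, l3, l4⟩ := li (s * p) (s * q) (q + s * r) (s * s) (by rw [← e2]; module)
  have s0 : s = 0 := by simpa using l4
  subst s0
  have q0 : q = 0 := by simpa using l3
  subst q0
  have x0 : x ≠ 0 := by rw [← b0]; exact B.ne_zero 0
  refine ⟨r, ?_⟩
  have e3 : ν x (w - r • y) = p • x := by
    simp only [map_sub, map_smul, h01, e]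
    module
  have e4 := hz (w - r • y) x
  rw [alt_swap hA (w - r • y) x, e3, map_neg, map_smul, alt_swap hA (w - r • y) x, e3] at e4
  have : (p * p) • x = 0 := by rw [← e4]; module
  have p0 : p = 0 := by simpa [x0] using this
  rw [e3, p0, zero_smul]

lemma Z_class {ν : Bil 4} (hL : LieMul ν) (hz : ∀ x y, ν x (ν x y) = 0) :
    ν = 0 ∨ ∃ f h u, ND f h u ∧ h u = 0 ∧ ν = M 0 f h u := by
  obtain ⟨hA, hJ⟩ := hL
  by_cases h0 : ∀ x y, ν x y = 0
  · left
    exact LinearMap.ext₂ h0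
  right
  push Not at h0
  obtain ⟨x, y, hzz⟩ := h0
  obtain ⟨z, h01⟩ : ∃ z, ν x y = z := ⟨_, rfl⟩
  rw [h01] at hzz
  have h02 : ν x z = 0 := by rw [← h01]; exact hz _ _
  have h10 : ν y x = - z := by rw [alt_swap hA, h01]
  have h12 : ν y z = 0 := by
    have := hz y x
    rw [h10, map_neg] at this
    simpa using this
  obtain ⟨w, li⟩ := extend_three (a := x) (b := y) (c := z) (by
    intro p q r e
    have e1 := congrArg (ν x) e
    have e2 := congrArg (ν y) e
    simp [hA, h01, h02, h10, h12, hzz] at e1 e2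
    subst e1 e2
    simpa [hzz] using e)
  obtain ⟨r, hr⟩ := Z_step hA hz li h01
  obtain ⟨r', hr'⟩ := Z_step hA hz (x := y) (y := x) (z := - z) (w := w - r • y) (by
    intro p q s t e
    obtain ⟨l1, l2, l3, l4⟩ := li q (p - t * r) (-s) t (by rw [← e]; module)
    subst l4
    simp at l2 l3
    exact ⟨l2, l1, l3, rfl⟩) h10
  have k1 : ν x (w - r • y - r' • x) = 0 := by
    rw [map_sub, hr, map_smul, hA]; simp
  refine n3_of_basis hA (x := x) (y := y) (z := z) (w := w - r • y - r' • x) ?_ h01 h02 k1 h12 hr' ?_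
  · intro p q s t e
    obtain ⟨l1, l2, l3, l4⟩ := li (p - t * r') (q - t * r) s t (by rw [← e]; module)
    subst l4
    simp at l1 l2
    exact ⟨l1, l2, l3, rfl⟩
  · have := hJ x y (w - r • y - r' • x)
    rw [hr', alt_swap hA (w - r • y - r' • x) x, k1, h01] at this
    rw [map_zero, neg_zero, map_zero, zero_add, zero_add] at this
    rw [alt_swap hA, this, neg_zero]

abbrev ee (i : Fin 4) : V 4 := Pi.single i 1

lemma n4_eq : n4 = M 0 (LinearMap.proj 0) (LinearMap.proj 1) (ee 2)
    + M 0 (LinearMap.proj 0) (LinearMap.proj 2) (ee 3) := by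
  refine LinearMap.ext₂ fun x y => ?_
  funext i
  simp only [n4, ofTable, LinearMap.mk₂_apply, LinearMap.add_apply, M_apply, Fin.sum_univ_four]
  fin_cases i <;> simp [E] <;> ring

lemma n4_alt (x : V 4) : n4 x x = 0 := by
  rw [n4_eq, LinearMap.add_apply, LinearMap.add_apply, M_alt, M_alt, add_zero]

lemma isom_n4 {ν : Bil 4} (hA : ∀ x, ν x x = 0) {x y z w : V 4}
    (li : ∀ p q r s : ℂ, p • x + q • y + r • z + s • w = 0 → p = 0 ∧ q = 0 ∧ r = 0 ∧ s = 0)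
    (h01 : ν x y = z) (h02 : ν x z = w) (h03 : ν x w = 0) (h12 : ν y z = 0) (h13 : ν y w = 0)
    (h23 : ν z w = 0) : Isom ν n4 := by
  obtain ⟨B, rfl, rfl, rfl, rfl⟩ := basis_four li
  refine isom_basis B (Pi.basisFun ℂ (Fin 4)) hA n4_alt ?_ ?_ ?_ ?_ ?_ ?_
  · rw [h01]; simp [n4_eq, M_apply]
  · rw [h02]; simp [n4_eq, M_apply]
  · rw [h03]; simp [n4_eq, M_apply]
  · rw [h12]; simp [n4_eq, M_apply]
  · rw [h13]; simp [n4_eq, M_apply]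
  · rw [h23]; simp [n4_eq, M_apply]

lemma nil_class {ν : Bil 4} (hL : LieMul ν) (hn : ∀ x y z w, ν x (ν y (ν z w)) = 0) :
    Isom ν n4 ∨ LE1 ν := by
  by_cases hz : ∀ x y, ν x (ν x y) = 0
  · right
    rcases Z_class hL hz with rfl | ⟨f, h, u, H, hu, rfl⟩
    · exact zero_LE1
    · exact n3_LE1 H hu
  left
  obtain ⟨hA, hJ⟩ := hL
  push Not at hz
  obtain ⟨x, y, hw⟩ := hz
  obtain ⟨z, h01⟩ : ∃ z, ν x y = z := ⟨_, rfl⟩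
  obtain ⟨w, h02⟩ : ∃ w, ν x z = w := ⟨_, rfl⟩
  rw [h01, h02] at hw
  have z0 : z ≠ 0 := by rintro rfl; simp at h02; exact hw h02.symm
  have aw : ∀ a, ν a w = 0 := by intro a; rw [← h02, ← h01]; exact hn _ _ _ _
  have h10 : ν y x = - z := by rw [alt_swap hA, h01]
  have li : ∀ p q r s : ℂ, p • x + q • y + r • z + s • w = 0 → p = 0 ∧ q = 0 ∧ r = 0 ∧ s = 0 := by
    intro p q r s e
    have e1 := congrArg (ν x) e
    have e2 := congrArg (ν x) e1
    have e3 := congrArg (ν y) e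
    simp [hA, h01, h02, aw, hw] at e2
    subst e2
    simp [hA, h01, h02, aw, hw] at e1
    subst e1
    simp [hA, h10, aw, z0] at e3
    subst e3
    simp [hw] at e
    simp [e]
  obtain ⟨B, b0, b1, b2, b3⟩ := basis_four li
  obtain ⟨p, q, r, s, e⟩ := expand4 B (ν y z)
  rw [b0, b1, b2, b3] at e
  have av : ∀ a, ν a (ν y z) = 0 := by intro a; rw [← h01]; exact hn _ _ _ _
  have e1 := av x
  have e2 := av y
  rw [e] at e1 e2
  simp only [map_add, map_smul, hA, h01, h02, aw] at e1
  obtain ⟨-, -, q0, r0⟩ := li 0 0 q r (by rw [← e1]; module)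
  subst q0 r0
  simp [hA, h10, aw, z0] at e2
  subst e2
  simp at e
  refine isom_n4 hA (x := x) (y := y - s • x) (z := z) (w := w) ?_ ?_ h02 (aw _) ?_ (aw _) (aw _)
  · intro a b c d k
    obtain ⟨l1, l2, l3, l4⟩ := li (a - b * s) b c d (by rw [← k]; module)
    subst l2
    simp at l1
    exact ⟨l1, rfl, l3, l4⟩
  · simp [h01, hA]
  · simp [e, h02]

lemma n4_not_isom {ν : Bil 4} (h : ∀ x y z, ν x (ν y z) = 0) : ¬ Isom ν n4 := by
  rintro ⟨g, hg⟩
  have : n4 (ee 0) (n4 (ee 0) (ee 1)) = 0 := by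
    rw [← hg]; simp [h]
  have := congrFun this 3
  simp [n4_eq, M_apply] at this

lemma n3_mem_closure : M 0 (LinearMap.proj 0) (LinearMap.proj 1) (ee 2) ∈ closure (orb n4) := by
  refine mem_closure_fam (fun t => M 0 (LinearMap.proj 0) (LinearMap.proj 1) (ee 2)
    + M 0 (LinearMap.proj 0) (LinearMap.proj 2) (t • ee 3)) ?_ ?_
  · intro t ht
    apply Isom.symm
    refine isom_n4 (x := ee 0) (y := ee 1) (z := ee 2) (w := t • ee 3) ?_ ?_ ?_ ?_ ?_ ?_ ?_ ?_
    · intro x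
      rw [LinearMap.add_apply, LinearMap.add_apply, M_alt, M_alt, add_zero]
    · intro p q r s e
      have e0 := congrFun e 0
      have e1 := congrFun e 1
      have e2 := congrFun e 2
      have e3 := congrFun e 3
      simp [ht] at e0 e1 e2 e3
      exact ⟨e0, e1, e2, e3⟩
    all_goals simp [M_apply]
  · intro x y
    refine Tendsto.mono_left ?_ nhdsWithin_le_nhds
    have : Continuous (fun t : ℂ => (M 0 (LinearMap.proj 0) (LinearMap.proj 1) (ee 2)
      + M 0 (LinearMap.proj 0) (LinearMap.proj 2) (t • ee 3)) x y) := by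
      simp only [M_apply, LinearMap.add_apply]
      fun_prop
    have := this.tendsto 0
    simpa [M_apply] using this

lemma n4_levelTwo : levelTwo n4 := by
  constructor
  · rintro ν ⟨hν, hν'⟩
    have key : closure (orb n4) ⊆ {ν : Bil 4 | ((∀ x, ν x x = 0) ∧
        ∀ x y z, ν x (ν y z) + ν y (ν z x) + ν z (ν x y) = 0) ∧
        ∀ x y z w, ν x (ν y (ν z w)) = 0} := by
      refine closure_minimal ?_ ?_
      · rintro _ ⟨g, rfl⟩
        have hJ : ∀ x y z, n4 x (n4 y z) + n4 y (n4 z x) + n4 z (n4 x y) = 0 := by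
          intro x y z
          funext i
          simp [n4_eq, M_apply]
          fin_cases i <;> simp <;> ring
        have hn : ∀ x y z w, n4 x (n4 y (n4 z w)) = 0 := by
          intro x y z w
          funext i
          simp [n4_eq, M_apply]
        refine ⟨⟨act_alt _ n4_alt, ?_⟩, ?_⟩
        · intro x y z
          simp [← map_add, hJ]
        · intro x y z w
          simp [hn]
      · simp only [Set.ofPred_and, Set.ofPred_forall]
        refine IsClosed.inter (IsClosed.inter ?_ ?_) ?_
        · exact isClosed_iInter fun x => isClosed_eq (continuous_eval _ _) continuous_const
        · refine isClosed_iInter fun x => isClosed_iInter fun y => isClosed_iInter fun z => ?_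
          exact isClosed_eq (((continuous_eval' _ (continuous_eval _ _)).add
            (continuous_eval' _ (continuous_eval _ _))).add
            (continuous_eval' _ (continuous_eval _ _))) continuous_const
        · refine isClosed_iInter fun x => isClosed_iInter fun y => isClosed_iInter fun z =>
            isClosed_iInter fun w => ?_
          exact isClosed_eq (continuous_eval' _ (continuous_eval' _ (continuous_eval _ _)))
            continuous_const
    obtain ⟨hL, hn⟩ := key hν
    rcases nil_class hL hn with h | h
    · exact absurd h.symm hν'
    · exact h
  · refine ⟨_, ⟨n3_mem_closure, ?_⟩, ?_⟩
    · intro k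
      refine n4_not_isom ?_ (Isom.symm k)
      intro x y z
      simp [M_apply]
    · intro k
      have := congrFun (LinearMap.congr_fun₂ k (ee 0) (ee 1)) 2
      simp [M_apply] at this

def Lb (f : Fn) (A : V 4 →ₗ[ℂ] V 4) : Bil 4 :=
  LinearMap.mk₂ ℂ (fun x y => f x • A y - f y • A x)
    (fun x x' y => by simp only [map_add]; module)
    (fun a x y => by simp only [map_smul, smul_eq_mul]; module)
    (fun x y y' => by simp only [map_add]; module)
    (fun a x y => by simp only [map_smul, smul_eq_mul]; module)

lemma Lb_apply (f : Fn) (A : V 4 →ₗ[ℂ] V 4) (x y : V 4) :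
    Lb f A x y = f x • A y - f y • A x := rfl

lemma Lb_alt (f : Fn) (A : V 4 →ₗ[ℂ] V 4) (x : V 4) : Lb f A x x = 0 := by
  rw [Lb_apply]; module

/-- projection of `ad x` along `x` -/
def Ax (lam : Bil 4) (f : Fn) (x : V 4) : V 4 →ₗ[ℂ] V 4 :=
  lam x - (f ∘ₗ lam x).smulRight x

lemma Ax_apply (lam : Bil 4) (f : Fn) (x y : V 4) :
    Ax lam f x y = lam x y - f (lam x y) • x := by simp [Ax]

def gt (f : Fn) (x : V 4) (hx : f x = 1) (t : ℂ) (ht : t ≠ 0) : V 4 ≃ₗ[ℂ] V 4 :=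
  LinearEquiv.ofLinearMap (t⁻¹ • LinearMap.id + (1 - t⁻¹) • f.smulRight x)
    (t • LinearMap.id + (1 - t) • f.smulRight x)
    (by
      refine LinearMap.ext fun y => ?_
      simp [hx, smul_smul]
      rw [inv_mul_cancel₀ ht, one_smul, ← sub_eq_zero]
      match_scalars <;> field_simp <;> ring)
    (by
      refine LinearMap.ext fun y => ?_
      simp [hx, smul_smul]
      rw [mul_inv_cancel₀ ht, one_smul, ← sub_eq_zero]
      match_scalars <;> field_simp <;> ring)

lemma IW {lam : Bil 4} (hA : ∀ x, lam x x = 0) {f : Fn} {x : V 4} (hx : f x = 1) :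
    Lb f (Ax lam f x) ∈ closure (orb lam) := by
  refine mem_closure_fam (fun t => if ht : t = 0 then lam else act (gt f x hx t ht) lam) ?_ ?_
  · intro t ht
    simp only [ht, dite_false]
    exact ⟨_, rfl⟩
  · intro y z
    let P : V 4 → V 4 := fun y => y - f y • x
    let G : ℂ → V 4 := fun t =>
      f y • (lam x z + (t - 1) • f (lam x z) • x) - f z • (lam x y + (t - 1) • f (lam x y) • x)
        + t • (lam (P y) (P z) + (t - 1) • f (lam (P y) (P z)) • x)
    have hG : Tendsto G (𝓝[≠] 0) (𝓝 (Lb f (Ax lam f x) y z)) := by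
      refine Tendsto.mono_left ?_ nhdsWithin_le_nhds
      have : Continuous G := by
        simp only [G]
        fun_prop
      have := this.tendsto 0
      have e : G 0 = Lb f (Ax lam f x) y z := by
        simp [G, Lb_apply, Ax_apply, sub_eq_add_neg]
      rwa [e] at this
    refine hG.congr' ?_
    filter_upwards [self_mem_nhdsWithin] with t ht
    have ht : t ≠ 0 := ht
    simp only [ht, dite_false, act_apply]
    have s1 : ∀ v, (gt f x hx t ht).symm v = t • P v + f v • x := by
      intro v
      simp [gt, P]
      module
    have s2 : ∀ v, (gt f x hx t ht) v = t⁻¹ • v + (1 - t⁻¹) • f v • x := fun v => by simp [gt]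
    have lz : ∀ v, lam x (P v) = lam x v := fun v => by simp [P, hA]
    have zl : ∀ v, lam (P v) x = - lam x v := fun v => by rw [alt_swap hA, lz]
    rw [s1, s1, s2]
    simp only [map_add, LinearMap.add_apply, map_smul, LinearMap.smul_apply, lz, zl, hA, smul_zero,
      add_zero, G, map_neg, smul_neg, map_sub, smul_eq_mul]
    match_scalars <;> field_simp <;> ring

lemma n4_mem_Lb {f : Fn} {A : V 4 →ₗ[ℂ] V 4} (hfA : ∀ y, f (A y) = 0) {x y : V 4} (hx : f x = 1)
    (hAx : A x = 0)
    (li : ∀ p q r s : ℂ, p • x + q • y + r • A y + s • A (A y) = 0 →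
      p = 0 ∧ q = 0 ∧ r = 0 ∧ s = 0) (hy : f y = 0) : n4 ∈ closure (orb (Lb f A)) := by
  obtain ⟨B, b0, b1, b2, b3⟩ := basis_four li
  obtain ⟨p, q, r, s, e⟩ := expand4 B (A (A (A y)))
  rw [b0, b1, b2, b3] at e
  have p0 : p = 0 := by
    have := congrArg f e
    simp [hfA, hx, hy] at this
    exact this.symm
  subst p0
  refine mem_closure_fam (fun t => n4 + M 0 (LinearMap.proj 0) (LinearMap.proj 3)
    ((t ^ 3 * q) • ee 1 + (t ^ 2 * r) • ee 2 + (t * s) • ee 3)) ?_ ?_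
  · intro t ht
    obtain ⟨C, c0, c1, c2, c3⟩ := basis_four (a := t • x) (b := y) (c := t • A y)
      (d := t ^ 2 • A (A y)) (by
        intro p q r s k
        obtain ⟨l1, l2, l3, l4⟩ := li (p * t) q (r * t) (s * t ^ 2) (by rw [← k]; module)
        simpa [ht] using And.intro l1 (And.intro l2 (And.intro l3 l4)))
    refine isom_basis C (Pi.basisFun ℂ (Fin 4)) (Lb_alt _ _) ?_ ?_ ?_ ?_ ?_ ?_ ?_
    · intro x
      rw [LinearMap.add_apply, LinearMap.add_apply, M_alt, n4_alt, add_zero]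
    · have : Lb f A (C 0) (C 1) = C 2 := by
        simp [Lb_apply, c0, c1, c2, hx, hy, hAx]
      rw [this]; simp [n4_eq, M_apply]
    · have : Lb f A (C 0) (C 2) = C 3 := by
        simp [Lb_apply, c0, c2, c3, hx, hfA, hAx]
        module
      rw [this]; simp [n4_eq, M_apply]
    · have : Lb f A (C 0) (C 3) = (t ^ 3 * q) • C 1 + (t ^ 2 * r) • C 2 + (t * s) • C 3 := by
        simp [Lb_apply, c0, c1, c2, c3, hx, hfA, hAx, e]
        module
      rw [this]; simp [n4_eq, M_apply]
    · have : Lb f A (C 1) (C 2) = 0 := by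
        simp [Lb_apply, c1, c2, hy, hfA]
      rw [this]; simp [n4_eq, M_apply]
    · have : Lb f A (C 1) (C 3) = 0 := by
        simp [Lb_apply, c1, c3, hy, hfA]
      rw [this]; simp [n4_eq, M_apply]
    · have : Lb f A (C 2) (C 3) = 0 := by
        simp [Lb_apply, c2, c3, hfA]
      rw [this]; simp [n4_eq, M_apply]
  · intro x y
    refine Tendsto.mono_left ?_ nhdsWithin_le_nhds
    have : Continuous (fun t : ℂ => (n4 + M 0 (LinearMap.proj 0) (LinearMap.proj 3)
      ((t ^ 3 * q) • ee 1 + (t ^ 2 * r) • ee 2 + (t * s) • ee 3)) x y) := by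
      simp only [M_apply, LinearMap.add_apply]
      fun_prop
    have := this.tendsto 0
    simpa [M_apply] using this

lemma cramer3 {a1 a2 a3 b1 b2 b3 c1 c2 c3 q r s : ℂ}
    (h1 : q * a1 + r * b1 + s * c1 = 0) (h2 : q * a2 + r * b2 + s * c2 = 0)
    (h3 : q * a3 + r * b3 + s * c3 = 0)
    (hD : a1 * (b2 * c3 - b3 * c2) - b1 * (a2 * c3 - a3 * c2) + c1 * (a2 * b3 - a3 * b2) ≠ 0) :
    q = 0 ∧ r = 0 ∧ s = 0 := by
  refine ⟨?_, ?_, ?_⟩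
  · refine (mul_eq_zero.1 ?_).resolve_left hD
    linear_combination (b2 * c3 - b3 * c2) * h1 + (b3 * c1 - b1 * c3) * h2 + (b1 * c2 - b2 * c1) * h3
  · refine (mul_eq_zero.1 ?_).resolve_left hD
    linear_combination (a3 * c2 - a2 * c3) * h1 + (a1 * c3 - a3 * c1) * h2 + (a2 * c1 - a1 * c2) * h3
  · refine (mul_eq_zero.1 ?_).resolve_left hD
    linear_combination (a2 * b3 - a3 * b2) * h1 + (a3 * b1 - a1 * b3) * h2 + (a1 * b2 - a2 * b1) * h3

lemma D_scal {f : Fn} {A : V 4 →ₗ[ℂ] V 4} (hfA : ∀ y, f (A y) = 0) {x : V 4} (hx : f x = 1)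
    (hAx : A x = 0)
    (h : ∀ w, f w = 0 → ¬ ∀ p q : ℂ, p • w + q • A w = 0 → p = 0 ∧ q = 0) :
    ∃ c, Lb f A = M c f 0 0 := by
  have hr : ∀ y ∈ LinearMap.ker f, A y ∈ LinearMap.ker f := fun y _ => hfA y
  obtain ⟨c, hc⟩ := LinearMap.exists_eq_smul_id_of_forall_notLinearIndependent
    (f := A.restrict hr) (by
      rintro ⟨w, hw⟩ hli
      refine h w hw fun p q e => ?_
      rw [LinearIndependent.pair_iff] at hli
      exact hli p q (by ext1; simpa using e))
  have key : ∀ y, f y = 0 → A y = c • y := fun y hy => by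
    have := congrArg Subtype.val (LinearMap.congr_fun hc ⟨y, hy⟩)
    simpa using this
  have key2 : ∀ y, A y = c • (y - f y • x) := fun y => by
    rw [← key (y - f y • x) (by simp [hx])]
    simp [hAx]
  refine ⟨c, LinearMap.ext₂ fun y z => ?_⟩
  rw [Lb_apply, M_apply, key2, key2]
  simp only [LinearMap.zero_apply]
  module

lemma lemD {f : Fn} {A : V 4 →ₗ[ℂ] V 4} (hfA : ∀ y, f (A y) = 0) {x : V 4} (hx : f x = 1)
    (hAx : A x = 0)
    (hn : ∀ y, f y = 0 → ¬ ∀ p q r s : ℂ, p • x + q • y + r • A y + s • A (A y) = 0 →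
      p = 0 ∧ q = 0 ∧ r = 0 ∧ s = 0) :
    ∃ c h u, f u = 0 ∧ Lb f A = M c f h u ∧ (u = 0 ∨ ND f h u) := by
  by_cases hs : ∀ w, f w = 0 → ¬ ∀ p q : ℂ, p • w + q • A w = 0 → p = 0 ∧ q = 0
  · obtain ⟨c, hc⟩ := D_scal hfA hx hAx hs
    exact ⟨c, 0, 0, map_zero _, hc, Or.inl rfl⟩
  push Not at hs
  obtain ⟨w, hw, hli⟩ := hs
  replace hli : ∀ p q : ℂ, p • w + q • A w = 0 → p = 0 ∧ q = 0 := hli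
  obtain ⟨w', hw'⟩ : ∃ w', w' = A w := ⟨_, rfl⟩
  have fw' : f w' = 0 := hw' ▸ hfA w
  obtain ⟨v0, hv0⟩ := extend_three (a := x) (b := w) (c := w') (by
    intro p q r e
    have e' := congrArg f e
    simp [hx, hw, fw'] at e'
    subst e'
    refine ⟨rfl, hli q r ?_⟩
    rw [← hw']; simpa using e)
  obtain ⟨v, hv⟩ : ∃ v, v = v0 - f v0 • x := ⟨_, rfl⟩
  have fv : f v = 0 := by simp [hv, hx]
  have li : ∀ p q r s : ℂ, p • x + q • w + r • w' + s • v = 0 →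
      p = 0 ∧ q = 0 ∧ r = 0 ∧ s = 0 := by
    intro p q r s e
    obtain ⟨h1, h2, h3, h4⟩ := hv0 (p - s * f v0) q r s (by rw [← e, hv]; module)
    subst h4
    exact ⟨by simpa using h1, h2, h3, rfl⟩
  obtain ⟨B, b0, b1, b2, b3⟩ := basis_four li
  have ex : ∀ y, ∃ q r s : ℂ, A y = q • w + r • w' + s • v := fun y => by
    obtain ⟨p, q, r, s, e⟩ := expand4 B (A y)
    rw [b0, b1, b2, b3] at e
    have e' := congrArg f e
    simp [hfA, hx, hw, fw', fv] at e'
    exact ⟨q, r, s, by rw [e, ← e']; simp⟩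
  obtain ⟨r', s, g, eAA⟩ := ex w'
  obtain ⟨r, rfl⟩ : ∃ r, r' = -r := ⟨-r', by simp⟩
  obtain ⟨p1, p2, d, eAv⟩ := ex v
  have g0 : g = 0 := by
    by_contra hg
    refine hn w hw fun p q r1 s1 e => ?_
    rw [← hw', eAA] at e
    obtain ⟨h1, h2, h3, h4⟩ := li p (q - s1 * r) (r1 + s1 * s) (s1 * g) (by rw [← e]; module)
    have := (mul_eq_zero.1 h4).resolve_right hg
    subst this
    exact ⟨h1, by simpa using h2, by simpa using h3, rfl⟩
  subst g0
  have det : ∀ τ : ℂ, τ ≠ 0 → (1 + τ * p2) * d ^ 2 - d * (τ * p1 + s * (1 + τ * p2) + τ * d * p2)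
      + τ * p1 * (τ * p1 + s * (1 + τ * p2) + τ * d * p2)
      - (1 + τ * p2) * (-r * (1 + τ * p2) + τ * d * p1) = 0 := by
    intro τ hτ
    by_contra hD
    refine hn (w + τ • v) (by simp [hw, fv]) fun p q r1 s1 e => ?_
    have e1 : A (w + τ • v) = (τ * p1) • w + (1 + τ * p2) • w' + (τ * d) • v := by
      rw [map_add, map_smul, ← hw', eAv]; module
    have e2 : A (A (w + τ • v)) = (-r * (1 + τ * p2) + τ * d * p1) • w
        + (τ * p1 + s * (1 + τ * p2) + τ * d * p2) • w' + (τ * d ^ 2) • v := by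
      rw [e1]
      simp only [map_add, map_smul]
      rw [← hw', eAA, eAv]; module
    rw [e2, e1] at e
    obtain ⟨h1, h2, h3, h4⟩ := li p
      (q * 1 + r1 * (τ * p1) + s1 * (-r * (1 + τ * p2) + τ * d * p1))
      (q * 0 + r1 * (1 + τ * p2) + s1 * (τ * p1 + s * (1 + τ * p2) + τ * d * p2))
      (q * τ + r1 * (τ * d) + s1 * (τ * d ^ 2)) (by rw [← e]; module)
    refine ⟨h1, cramer3 h2 h3 h4 ?_⟩
    intro h
    apply hD
    apply mul_left_cancel₀ hτ
    linear_combination h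
  have d1 := det 1 one_ne_zero
  have d2 := det (-1) (by norm_num)
  have d3 := det 2 two_ne_zero
  clear det
  have c0 : d ^ 2 - s * d + r = 0 := by
    linear_combination d1 + (1/3) * d2 - (1/3) * d3
  have c1 : (s - d - d) * (p1 + d * p2) = 0 := by
    linear_combination (1/2) * d1 - (1/2) * d2 - 2 * p2 * c0
  have c2 : (p1 + (s - d) * p2) * (p1 + d * p2) = 0 := by
    linear_combination (1/2) * d1 + (1/2) * d2 - c0 - p2 ^ 2 * c0
  have c3 : p1 + d * p2 = 0 := by
    by_contra hh
    have k1 := (mul_eq_zero.1 c1).resolve_right hh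
    have k2 := (mul_eq_zero.1 c2).resolve_right hh
    exact hh (by linear_combination k2 - p2 * k1)
  have hp1 : p1 = - d * p2 := by linear_combination c3
  have hr : r = s * d - d ^ 2 := by linear_combination c0
  refine ⟨d, B.coord 1 + (s - d) • B.coord 2 + p2 • B.coord 3, w' - d • w, by simp [fw', hw], ?_, ?_⟩
  · refine ext_basis4 B (Lb_alt _ _) (M_alt _ _ _ _) ?_ ?_ ?_ ?_ ?_ ?_
    · rw [Lb_apply, M_apply]
      simp
      simp only [b0, b1, hx, hw, hAx, ← hw']; module
    · rw [Lb_apply, M_apply]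
      simp
      simp only [b0, b2, hx, fw', hAx, eAA, hr]; module
    · rw [Lb_apply, M_apply]
      simp
      simp only [b0, b3, hx, fv, hAx, eAv, hp1]; module
    all_goals
      rw [Lb_apply, M_apply]
      simp [b1, b2, b3, hw, fw', fv]
  · right
    refine ⟨fun h => ?_, by simp [fw', hw], x, w, hx, hw, ?_, ?_⟩
    · have := (hli (-d) 1 (by rw [← hw', ← h]; module)).2
      exact one_ne_zero this
    · simp [← b0]
    · simp [← b1]

lemma r2a2_eq : r2a2 = M 0 (LinearMap.proj 0) (LinearMap.proj 1) (ee 1) := by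
  refine LinearMap.ext₂ fun x y => ?_
  funext i
  simp only [r2a2, ofTable, LinearMap.mk₂_apply, M_apply, Fin.sum_univ_four]
  fin_cases i <;> simp [E] <;> ring

lemma r31a1_eq : r31a1 = M 1 (LinearMap.proj 0) (LinearMap.proj 3) (-ee 3) := by
  refine LinearMap.ext₂ fun x y => ?_
  funext i
  simp only [r31a1, ofTable, LinearMap.mk₂_apply, M_apply, Fin.sum_univ_four]
  fin_cases i <;> simp [E] <;> ring

lemma g41_eq (α : ℂ) : g41 α = M 1 (LinearMap.proj 0) (LinearMap.proj 1) ((α - 1) • ee 1) := by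
  refine LinearMap.ext₂ fun x y => ?_
  funext i
  simp only [g41, ofTable, LinearMap.mk₂_apply, M_apply, Fin.sum_univ_four]
  fin_cases i <;> simp [E] <;> ring

lemma g42_eq : g42 = M 1 (LinearMap.proj 0) (LinearMap.proj 1) (ee 2) := by
  refine LinearMap.ext₂ fun x y => ?_
  funext i
  simp only [g42, ofTable, LinearMap.mk₂_apply, M_apply, Fin.sum_univ_four]
  fin_cases i <;> simp [E] <;> ring

lemma ND_std {i j : Fin 4} {a : ℂ} (hi : i ≠ 0) (hj : j ≠ 0) (ha : a ≠ 0) :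
    ND (LinearMap.proj 0) (LinearMap.proj i) (a • ee j) := by
  refine ⟨?_, ?_, ee 0, ee i, ?_, ?_, ?_, ?_⟩
  · simp [ha]
  · simp [hj.symm]
  · simp
  · simp [hi.symm]
  · simp [hi]
  · simp

lemma ND_r2a2 : ND (LinearMap.proj 0) (LinearMap.proj 1) (ee 1) := by
  simpa using ND_std (i := 1) (j := 1) (a := 1) (by decide) (by decide) one_ne_zero

lemma ND_r31a1 : ND (LinearMap.proj 0) (LinearMap.proj 3) (-ee 3) := by
  simpa using ND_std (i := 3) (j := 3) (a := -1) (by decide) (by decide) (by norm_num)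

lemma ND_g42 : ND (LinearMap.proj 0) (LinearMap.proj 1) (ee 2) := by
  simpa using ND_std (i := 1) (j := 2) (a := 1) (by decide) (by decide) one_ne_zero

/-- the list of the theorem -/
def InList (lam : Bil 4) : Prop :=
  Isom lam n4 ∨ Isom lam r2a2 ∨ Isom lam r31a1 ∨
        (∃ α : ℂ, α ≠ 0 ∧ α ≠ 1 ∧ Isom lam (g41 α)) ∨ Isom lam g42

lemma InList.congr {lam mu : Bil 4} (h : Isom lam mu) (H : InList mu) : InList lam := by
  rcases H with H | H | H | ⟨α, h0, h1, H⟩ | H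
  · exact Or.inl (h.trans H)
  · exact Or.inr (Or.inl (h.trans H))
  · exact Or.inr (Or.inr (Or.inl (h.trans H)))
  · exact Or.inr (Or.inr (Or.inr (Or.inl ⟨α, h0, h1, h.trans H⟩)))
  · exact Or.inr (Or.inr (Or.inr (Or.inr (h.trans H))))

lemma InList.levelTwo {lam : Bil 4} (H : InList lam) : levelTwo lam := by
  rcases H with H | H | H | ⟨α, h0, h1, H⟩ | H <;> rw [levelTwo_congr H]
  · exact n4_levelTwo
  · rw [r2a2_eq]; exact M_levelTwo ND_r2a2 (Or.inr (by simp))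
  · rw [r31a1_eq]; exact M_levelTwo ND_r31a1 (Or.inl one_ne_zero)
  · rw [g41_eq]
    exact M_levelTwo (ND_std (by decide) (by decide) (sub_ne_zero.2 h1)) (Or.inl one_ne_zero)
  · rw [g42_eq]; exact M_levelTwo ND_g42 (Or.inl one_ne_zero)

lemma M_list {c : ℂ} {f h : Fn} {u : V 4} (H : ND f h u) (hk : c ≠ 0 ∨ h u ≠ 0) :
    InList (M c f h u) := by
  unfold InList
  by_cases hc : c = 0
  · subst hc
    have hu : h u ≠ 0 := by simpa using hk
    right; left
    have := M_isom' (s := (h u)⁻¹) (c := 0) (inv_ne_zero hu) H ND_r2a2 (by simp [hu])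
    rwa [mul_zero, ← r2a2_eq] at this
  right; right
  have hc' : c⁻¹ ≠ 0 := inv_ne_zero hc
  by_cases h0 : h u = 0
  · right; right
    have := M_isom' (c := c) hc' H ND_g42 (by simp [h0])
    rwa [inv_mul_cancel₀ hc, ← g42_eq] at this
  by_cases h1 : c⁻¹ * h u = -1
  · left
    have := M_isom' (c := c) hc' H ND_r31a1 (by simp [h1])
    rwa [inv_mul_cancel₀ hc, ← r31a1_eq] at this
  · right; left
    have h2 : c⁻¹ * h u ≠ 0 := mul_ne_zero hc' h0
    refine ⟨c⁻¹ * h u + 1, fun h => h1 (by linear_combination h), by simpa using h2, ?_⟩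
    have := M_isom' (c := c) hc' H (ND_std (i := 1) (j := 1) (a := c⁻¹ * h u)
      (by decide) (by decide) h2) (by simp)
    rw [inv_mul_cancel₀ hc] at this
    rw [g41_eq, add_sub_cancel_right]
    exact this

lemma n4_not_LE1 : ¬ LE1 n4 := fun h => not_levelTwo_of_LE1 h n4_levelTwo

lemma Lb_list {f : Fn} {A : V 4 →ₗ[ℂ] V 4} (hfA : ∀ y, f (A y) = 0) {x : V 4} (hx : f x = 1)
    (hAx : A x = 0) (h2 : levelTwo (Lb f A)) : InList (Lb f A) := by
  by_cases hn : ∀ y, f y = 0 → ¬ ∀ p q r s : ℂ, p • x + q • y + r • A y + s • A (A y) = 0 →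
      p = 0 ∧ q = 0 ∧ r = 0 ∧ s = 0
  · obtain ⟨c, h, u, -, e, hu⟩ := lemD hfA hx hAx hn
    rw [e] at h2 ⊢
    rcases hu with rfl | H
    · exact absurd h2 (not_levelTwo_of_LE1 (scal_LE1 _ _ _))
    by_cases hk : c ≠ 0 ∨ h u ≠ 0
    · exact M_list H hk
    · push Not at hk
      obtain ⟨rfl, hu⟩ := hk
      exact absurd h2 (not_levelTwo_of_LE1 (n3_LE1 H hu))
  · push Not at hn
    obtain ⟨y, hy, li⟩ := hn
    have hm := n4_mem_Lb hfA hx hAx (y := y) (fun p q r s e => li p q r s e) hy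
    by_cases ho : n4 ∈ orb (Lb f A)
    · exact Or.inl ho
    · exact absurd (h2.1 n4 ⟨hm, ho⟩) n4_not_LE1

lemma Lb_LE1 {f : Fn} {A : V 4 →ₗ[ℂ] V 4} (hfA : ∀ y, f (A y) = 0) {x : V 4} (hx : f x = 1)
    (hAx : A x = 0) (h1 : LE1 (Lb f A)) :
    (∃ c : ℂ, ∀ y, A y = c • (y - f y • x)) ∨ ∀ y, A (A y) = 0 := by
  by_cases hn : ∀ y, f y = 0 → ¬ ∀ p q r s : ℂ, p • x + q • y + r • A y + s • A (A y) = 0 →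
      p = 0 ∧ q = 0 ∧ r = 0 ∧ s = 0
  · obtain ⟨c, h, u, fu, e, hu⟩ := lemD hfA hx hAx hn
    have key : ∀ y, A y = c • (y - f y • x) + (h y - f y * h x) • u := fun y => by
      have := LinearMap.congr_fun₂ e x y
      rw [Lb_apply, M_apply, hx, hAx] at this
      simpa using this
    rcases hu with rfl | H
    · exact Or.inl ⟨c, fun y => by rw [key]; simp⟩
    right
    by_cases hk : c ≠ 0 ∨ h u ≠ 0
    · rw [e] at h1
      exact absurd (M_levelTwo H hk) (not_levelTwo_of_LE1 h1)
    · push Not at hk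
      obtain ⟨rfl, hu⟩ := hk
      intro y
      rw [key (A y), hfA, key y]
      simp [hu]
  · push Not at hn
    obtain ⟨y, hy, li⟩ := hn
    have hm := n4_mem_Lb hfA hx hAx (y := y) (fun p q r s e => li p q r s e) hy
    rcases h1 hm with ho | ho
    · exact absurd ((LE1_congr ho).1 h1) n4_not_LE1
    · have ho' : n4 = 0 := ho
      exact absurd (ho' ▸ zero_LE1) n4_not_LE1

lemma exists_dual {x : V 4} (hx : x ≠ 0) : ∃ f : Fn, f x = 1 := by
  obtain ⟨i, hi⟩ := exists_coord hx
  exact ⟨(x i)⁻¹ • LinearMap.proj i, by simp [hi]⟩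

lemma Z_final {lam : Bil 4} (hL : LieMul lam) (h : ∀ x y, ∃ k : ℂ, lam x (lam x y) = k • x) :
    LE1 lam := by
  have hz : ∀ x y, lam x (lam x y) = 0 := by
    intro x y
    obtain ⟨k, hk⟩ := h x y
    obtain ⟨v, hv⟩ : ∃ v, v = lam x y := ⟨_, rfl⟩
    rw [← hv] at hk ⊢
    by_contra hne
    have k0 : k ≠ 0 := by rintro rfl; exact hne (by simpa using hk)
    obtain ⟨m, hm⟩ := h v x
    have e : lam v x = -(k • x) := by rw [alt_swap hL.1, hk]
    have e2 : lam v (lam v x) = (k * k) • x := by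
      rw [e, map_neg, map_smul, e]; module
    rw [e2] at hm
    have : x = ((k * k)⁻¹ * m) • v := by
      rw [mul_smul, ← hm, smul_smul, inv_mul_cancel₀ (mul_ne_zero k0 k0), one_smul]
    apply hne
    rw [this, map_smul, LinearMap.smul_apply, hL.1, smul_zero]
  rcases Z_class hL hz with rfl | ⟨f, h, u, H, hu, rfl⟩
  · exact zero_LE1
  · exact n3_LE1 H hu

lemma S_final {lam : Bil 4} (hA : ∀ x, lam x x = 0) (F : Fn) (hF : F ≠ 0)
    (h : ∀ x y, F x ≠ 0 → ∃ k : ℂ, lam x y - F x • y = k • x) : LE1 lam := by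
  have key : ∀ x y, F x ≠ 0 → F y ≠ 0 → lam x y = M 1 F 0 0 x y := by
    intro x y hx hy
    rw [M_apply]
    obtain ⟨k, hk⟩ := h x y hx
    obtain ⟨m, hm⟩ := h y x hy
    rw [alt_swap hA y x] at hm
    have e : (k + F y) • x = - ((m + F x) • y) := by
      rw [add_smul, add_smul, ← hk, ← hm]; module
    by_cases hc : k + F y = 0
    · have : k = - F y := by linear_combination hc
      rw [this] at hk
      rw [sub_eq_iff_eq_add.1 hk]
      simp; module
    · have ex : x = ((k + F y)⁻¹ * -(m + F x)) • y := by
        rw [mul_smul, neg_smul, ← e, smul_smul, inv_mul_cancel₀ hc, one_smul]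
      rw [ex]
      simp [hA]
      module
  obtain ⟨x0, hx0⟩ : ∃ x0, F x0 ≠ 0 := by
    by_contra hh
    push Not at hh
    exact hF (LinearMap.ext hh)
  have key2 : ∀ x y, F x ≠ 0 → lam x y = M 1 F 0 0 x y := by
    intro x y hx
    by_cases hy : F y = 0
    · have := key x (y + x0) hx (by simpa [hy] using hx0)
      rw [map_add, map_add, key x x0 hx hx0] at this
      exact add_right_cancel this
    · exact key x y hx hy
  have : lam = M 1 F 0 0 := by
    refine LinearMap.ext₂ fun x y => ?_
    by_cases hx : F x = 0
    · have := key2 (x + x0) y (by simpa [hx] using hx0)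
      rw [map_add, map_add, LinearMap.add_apply, LinearMap.add_apply, key2 x0 y hx0] at this
      exact add_right_cancel this
    · exact key2 x y hx
  rw [this]
  exact scal_LE1 _ _ _

lemma forward {lam : Bil 4} (hL : LieMul lam) (h2 : levelTwo lam) : InList lam := by
  have hfA : ∀ (f : Fn) (x : V 4), f x = 1 → ∀ y, f (Ax lam f x y) = 0 := fun f x hx y => by
    simp [Ax_apply, hx]
  have hAx : ∀ (f : Fn) (x : V 4), Ax lam f x x = 0 := fun f x => by simp [Ax_apply, hL.1]
  by_cases ho : ∃ (f : Fn) (x : V 4), f x = 1 ∧ Lb f (Ax lam f x) ∈ orb lam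
  · obtain ⟨f, x, hx, ho⟩ := ho
    exact InList.congr ho (Lb_list (hfA f x hx) hx (hAx f x) ((levelTwo_congr ho).1 h2))
  exfalso
  push Not at ho
  have alt : ∀ (f : Fn) (x : V 4), f x = 1 →
      (∃ c : ℂ, ∀ y, Ax lam f x y = c • (y - f y • x)) ∨
        ∀ y, Ax lam f x (Ax lam f x y) = 0 := fun f x hx =>
    Lb_LE1 (hfA f x hx) hx (hAx f x) (h2.1 _ ⟨IW hL.1 hx, ho f x hx⟩)
  have dich : ∀ x, x ≠ 0 → (∃ f : Fn, f x = 1 ∧ ∀ y, lam x y =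
      (LinearMap.trace ℂ (V 4) (lam x) / 3) • (y - f y • x) + f (lam x y) • x) ∨
      (LinearMap.trace ℂ (V 4) (lam x) = 0 ∧ ∀ y, ∃ k : ℂ, lam x (lam x y) = k • x) := by
    intro x hx0
    obtain ⟨f, hx⟩ := exists_dual hx0
    rcases alt f x hx with ⟨c, hc⟩ | hz
    · left
      refine ⟨f, hx, fun y => ?_⟩
      have e : lam x = c • (LinearMap.id - f.smulRight x) + (f ∘ₗ lam x).smulRight x := by
        refine LinearMap.ext fun y => ?_
        have := hc y
        rw [Ax_apply, sub_eq_iff_eq_add] at this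
        simpa using this
      have ht : LinearMap.trace ℂ (V 4) (lam x) = 3 * c := by
        rw [e]
        simp [LinearMap.trace_smulRight, hx, hL.1]
        ring
      rw [ht, mul_div_cancel_left₀ _ (by norm_num)]
      have := hc y
      rwa [Ax_apply, sub_eq_iff_eq_add] at this
    · right
      have hk : ∀ y, ∃ k : ℂ, lam x (lam x y) = k • x := by
        intro y
        have := hz y
        rw [Ax_apply, Ax_apply, map_sub, map_smul, hL.1, smul_zero, sub_zero, sub_eq_zero] at this
        exact ⟨_, this⟩
      refine ⟨?_, hk⟩
      have hnil : IsNilpotent (lam x) := by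
        refine ⟨3, LinearMap.ext fun y => ?_⟩
        obtain ⟨k, hk⟩ := hk y
        simp [pow_succ, hk, hL.1]
      exact (LinearMap.isNilpotent_trace_of_isNilpotent hnil).eq_zero
  let T : Fn := LinearMap.trace ℂ (V 4) ∘ₗ lam
  have hT : ∀ x, T x = LinearMap.trace ℂ (V 4) (lam x) := fun _ => rfl
  refine not_levelTwo_of_LE1 ?_ h2
  by_cases h0 : T = 0
  · refine Z_final hL fun x y => ?_
    by_cases hx0 : x = 0
    · exact ⟨0, by simp [hx0]⟩
    have ht : LinearMap.trace ℂ (V 4) (lam x) = 0 := by rw [← hT, h0]; rfl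
    rcases dich x hx0 with ⟨f, hx, h⟩ | ⟨-, h⟩
    · refine ⟨0, ?_⟩
      rw [h y, ht]
      simp [hL.1]
    · exact h y
  · refine S_final hL.1 ((1/3 : ℂ) • T) (smul_ne_zero (by norm_num) h0) fun x y hx => ?_
    have hx' : T x ≠ 0 := by
      intro h; apply hx; simp [h]
    have hx0 : x ≠ 0 := by rintro rfl; simp at hx'
    rcases dich x hx0 with ⟨f, hx, h⟩ | ⟨h, -⟩
    · refine ⟨f (lam x y) - T x / 3 * f y, ?_⟩
      rw [← hT] at h
      have e : ((1/3 : ℂ) • T) x = T x / 3 := by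
        rw [LinearMap.smul_apply, smul_eq_mul]; ring
      rw [e]
      nth_rewrite 1 [h y]
      module
    · exact absurd h hx'

/-- classification of 4-dimensional Lie multiplications of level two. -/
theorem lie4_level_two (lam : Bil 4) (hL : LieMul lam) :
    levelTwo lam ↔
      (Isom lam n4 ∨ Isom lam r2a2 ∨ Isom lam r31a1 ∨
        (∃ α : ℂ, α ≠ 0 ∧ α ≠ 1 ∧ Isom lam (g41 α)) ∨ Isom lam g42) := by
  exact ⟨fun h => forward hL h, fun h => InList.levelTwo h⟩
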